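/- arXiv:1712.00896 — 3 statements merged into one kernel-verified Lean document; each statement's English description precedes it below -/
import Mathlib

section
/- The only subspaces of the quotient Q = N/P that are invariant under all induced operators E_{ij}(n) (i,j ∈ {1,2}, n ∈ ℤ²), D1, D2 are {0} and Q if and only if μ ∉ ℤ. -/
open MvPolynomial Finsupp

/-- The index set of the variables other than `x_m`. -/
abbrev NVar (m : ℤ × ℤ) := {p : ℤ × ℤ // p ≠ m}

/-- `N = ℂ[x_m, x_m^{−1}][x_n : n ≠ m]`, realized as finitely supported families,
indexed by the exponent of `x_m` (an arbitrary integer), of polynomials in the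
variables `x_n`, `n ≠ m`. -/
abbrev NN (m : ℤ × ℤ) := ℤ →₀ MvPolynomial (NVar m) ℂ

/-- Multiplication by `x_m^j` on `N` (for `j = -1` this is `X_m^{−1}`). -/
noncomputable def XmZ (m : ℤ × ℤ) (j : ℤ) (g : NN m) : NN m :=
  Finsupp.mapDomain (· + j) g

/-- Multiplication by `x_k` on `N` (the operator `X_k`). -/
noncomputable def Xop (m : ℤ × ℤ) (k : ℤ × ℤ) (g : NN m) : NN m :=
  if h : k = m then XmZ m 1 g
  else Finsupp.mapRange (fun a => X (⟨k, h⟩ : NVar m) * a) (by simp) g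

/-- The partial derivative `∂_s` on `N` (with `∂_m x_m^k = k x_m^{k−1}`, `k ∈ ℤ`). -/
noncomputable def Dop (m : ℤ × ℤ) (s : ℤ × ℤ) (g : NN m) : NN m :=
  if h : s = m then g.sum (fun k a => Finsupp.single (k - 1) (k • a))
  else Finsupp.mapRange (fun a => pderiv (⟨s, h⟩ : NVar m) a) (by simp) g

/-- A finite set of indices containing every `s` for which `∂_s` acts nonzero on `g`
(together with `m`); sums over all `s ∈ ℤ²` in the defining formulas reduce to sums
over this finite set. -/
noncomputable def nvars (m : ℤ × ℤ) (g : NN m) : Finset (ℤ × ℤ) :=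
  insert m (g.support.biUnion fun k => (g k).vars.image Subtype.val)

/-- `E21(n)` on `N`: multiplication by `x_n`. -/
noncomputable def E21N (m n : ℤ × ℤ) (g : NN m) : NN m := Xop m n g

/-- `E22(n) = Σ_s q^{s₁n₂} x_{n+s} ∂_s` on `N`. -/
noncomputable def E22N (q : ℂ) (m n : ℤ × ℤ) (g : NN m) : NN m :=
  ∑ s ∈ nvars m g, q ^ (s.1 * n.2) • Xop m (n + s) (Dop m s g)

/-- `E11(n) = δ_{n,0} μ id − Σ_s q^{s₂n₁} x_{n+s} ∂_s` on `N`. -/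
noncomputable def E11N (q μ : ℂ) (m n : ℤ × ℤ) (g : NN m) : NN m :=
  (if n = 0 then μ • g else 0) - ∑ s ∈ nvars m g, q ^ (s.2 * n.1) • Xop m (n + s) (Dop m s g)

/-- `E12(n) = q^{−n₁n₂} μ ∂_{−n} − Σ_{s,r} q^{n₂r₁+s₂n₁+s₂r₁} x_{n+s+r} ∂_s ∂_r` on `N`. -/
noncomputable def E12N (q μ : ℂ) (m n : ℤ × ℤ) (g : NN m) : NN m :=
  q ^ (-(n.1 * n.2)) • μ • Dop m (-n) g -
    ∑ s ∈ nvars m g, ∑ r ∈ nvars m g,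
      q ^ (n.2 * r.1 + s.2 * n.1 + s.2 * r.1) • Xop m (n + s + r) (Dop m s (Dop m r g))

/-- `𝓔_m = Σ_{s,r} q^{−m₂r₁−s₂m₁+s₂r₁} x_{−m+s+r} ∂_s ∂_r` on `N`. -/
noncomputable def EmN (q : ℂ) (m : ℤ × ℤ) (g : NN m) : NN m :=
  ∑ s ∈ nvars m g, ∑ r ∈ nvars m g,
    q ^ (-(m.2 * r.1) - s.2 * m.1 + s.2 * r.1) • Xop m (-m + s + r) (Dop m s (Dop m r g))

/-- `D1 = Σ_s s₁ x_s ∂_s` on `N`. -/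
noncomputable def D1N (m : ℤ × ℤ) (g : NN m) : NN m :=
  ∑ s ∈ nvars m g, (s.1 : ℂ) • Xop m s (Dop m s g)

/-- `D2 = Σ_s s₂ x_s ∂_s` on `N`. -/
noncomputable def D2N (m : ℤ × ℤ) (g : NN m) : NN m :=
  ∑ s ∈ nvars m g, (s.2 : ℂ) • Xop m s (Dop m s g)

/-- The copy of `P = ℂ[x_n : n ∈ ℤ²]` inside `N`: the elements with no negative
powers of `x_m`. -/
noncomputable def PinN (m : ℤ × ℤ) : Submodule ℂ (NN m) where
  carrier := {g | ∀ k : ℤ, k < 0 → g k = 0}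
  zero_mem' := fun _ _ => rfl
  add_mem' := fun {a b} ha hb k hk => by
    simp [Finsupp.add_apply, ha k hk, hb k hk]
  smul_mem' := fun c g hg k hk => by
    simp [Finsupp.smul_apply, hg k hk]

namespace LocQuot

variable {m : ℤ × ℤ}

theorem Xop_apply (k : ℤ × ℤ) (g : NN m) (j : ℤ) :
    Xop m k g j = if h : k = m then g (j - 1) else X (⟨k, h⟩ : NVar m) * g j := by
  unfold Xop
  split_ifs with h
  · have := Finsupp.mapDomain_apply (f := fun x : ℤ => x + 1) (add_left_injective 1) g (j - 1)
    simpa [XmZ] using this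
  · simp

theorem Dop_apply (s : ℤ × ℤ) (g : NN m) (j : ℤ) :
    Dop m s g j = if h : s = m then ((j : ℂ) + 1) • g (j + 1)
      else pderiv (⟨s, h⟩ : NVar m) (g j) := by
  unfold Dop
  split_ifs with h
  · rw [Finsupp.sum, Finsupp.finsetSum_apply]
    rw [Finset.sum_eq_single (j + 1)]
    · simp only [add_sub_cancel_right, Finsupp.single_eq_same]
      rw [← Int.cast_smul_eq_zsmul ℂ]
      push_cast
      rfl
    · intro b _ hb
      rw [Finsupp.single_eq_of_ne]
      intro h; apply hb; omega
    · intro h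
      simp [Finsupp.notMem_support_iff.1 h]
  · simp

/-- Multiplication by `x_k` as a linear map. -/
noncomputable def XL (k : ℤ × ℤ) : NN m →ₗ[ℂ] NN m where
  toFun := Xop m k
  map_add' a b := by
    ext1 j; simp only [Xop_apply, Finsupp.add_apply]; split_ifs <;> ring
  map_smul' c a := by
    ext1 j; simp only [Xop_apply, Finsupp.smul_apply, RingHom.id_apply]; split_ifs <;> simp

/-- The partial derivative `∂_s` as a linear map. -/
noncomputable def DL (s : ℤ × ℤ) : NN m →ₗ[ℂ] NN m where
  toFun := Dop m s
  map_add' a b := by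
    ext1 j; simp only [Dop_apply, Finsupp.add_apply]; split_ifs <;> simp
  map_smul' c a := by
    ext1 j; simp only [Dop_apply, Finsupp.smul_apply, RingHom.id_apply]
    split_ifs
    · rw [smul_comm]
    · simp

theorem XL_apply (k : ℤ × ℤ) (g : NN m) (j : ℤ) :
    XL k g j = if h : k = m then g (j - 1) else X (⟨k, h⟩ : NVar m) * g j := Xop_apply k g j

theorem DL_apply (s : ℤ × ℤ) (g : NN m) (j : ℤ) :
    DL s g j = if h : s = m then ((j : ℂ) + 1) • g (j + 1)
      else pderiv (⟨s, h⟩ : NVar m) (g j) := Dop_apply s g j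

theorem XL_comm (k l : ℤ × ℤ) (g : NN m) : XL k (XL l g) = XL l (XL k g) := by
  ext1 j
  simp only [XL_apply]
  split_ifs <;> first | rfl | ring

theorem pderiv_comm {σ : Type*} (i j : σ) (p : MvPolynomial σ ℂ) :
    pderiv i (pderiv j p) = pderiv j (pderiv i p) := by
  classical
  have h : ⁅pderiv (R := ℂ) i, pderiv (R := ℂ) j⁆ = 0 := by
    apply MvPolynomial.derivation_ext
    intro k
    simp [Derivation.commutator_apply, pderiv_X, Pi.single_apply, apply_ite]
  have := congrArg (fun d => d p) h
  simpa [Derivation.commutator_apply, sub_eq_zero] using this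

theorem DL_comm (k l : ℤ × ℤ) (g : NN m) : DL k (DL l g) = DL l (DL k g) := by
  ext1 j
  simp only [DL_apply]
  split_ifs
  · rfl
  · simp
  · simp
  · exact pderiv_comm _ _ _

theorem DL_XL (s k : ℤ × ℤ) (g : NN m) :
    DL s (XL k g) = XL k (DL s g) + if s = k then g else 0 := by
  ext1 j
  rw [Finsupp.add_apply]
  simp only [DL_apply, XL_apply]
  by_cases hs : s = m
  · subst hs
    by_cases hk : k = s
    · subst hk
      simp only [dite_true, if_true]
      rw [show j - 1 + 1 = j by ring, show j + 1 - 1 = j by ring]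
      push_cast
      rw [sub_add_cancel, add_smul, one_smul]
    · rw [if_neg (Ne.symm hk)]
      simp [hk]
  · by_cases hk : k = m
    · subst hk
      simp [hs]
    · by_cases h : s = k
      · subst h; simp [hs]
      · simp [hs, hk, h, pderiv_X, Ne.symm h]

/-- `∂_s g = 0` for all `s` outside the finite set `S`. -/
def Supp (S : Finset (ℤ × ℤ)) (g : NN m) : Prop := ∀ s ∉ S, DL s g = 0

theorem supp_nvars (g : NN m) : Supp (nvars m g) g := by
  intro s hs
  simp only [nvars, Finset.mem_insert, Finset.mem_biUnion, Finset.mem_image, not_or, not_exists,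
    not_and] at hs
  ext1 j
  rw [DL_apply, dif_neg hs.1]
  by_cases hj : j ∈ g.support
  · exact pderiv_eq_zero_of_notMem_vars fun h => hs.2 j hj ⟨s, hs.1⟩ h rfl
  · simp [Finsupp.notMem_support_iff.1 hj]

theorem Supp.mono {S T : Finset (ℤ × ℤ)} {g : NN m} (h : Supp S g) (hST : S ⊆ T) : Supp T g :=
  fun s hs => h s fun h' => hs (hST h')

theorem Supp.deriv {S : Finset (ℤ × ℤ)} {g : NN m} (h : Supp S g) (r : ℤ × ℤ) :
    Supp S (DL r g) := fun s hs => by rw [DL_comm, h s hs, map_zero]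

theorem Supp.add {S : Finset (ℤ × ℤ)} {g h : NN m} (hg : Supp S g) (hh : Supp S h) :
    Supp S (g + h) := fun s hs => by rw [map_add, hg s hs, hh s hs, add_zero]

theorem Supp.smul {S : Finset (ℤ × ℤ)} {g : NN m} (hg : Supp S g) (c : ℂ) :
    Supp S (c • g) := fun s hs => by rw [map_smul, hg s hs, smul_zero]

theorem Supp.mul {S : Finset (ℤ × ℤ)} {g : NN m} (hg : Supp S g) {k : ℤ × ℤ} (hk : k ∈ S) :
    Supp S (XL k g) := fun s hs => by
  rw [DL_XL, hg s hs, map_zero, if_neg (by rintro rfl; exact hs hk), add_zero]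

theorem sum_eq_of_supp {S T : Finset (ℤ × ℤ)} {g : NN m} (hS : Supp S g) (hT : Supp T g)
    (φ : ℤ × ℤ → NN m → NN m) (hφ : ∀ s, φ s 0 = 0) :
    ∑ s ∈ S, φ s (DL s g) = ∑ s ∈ T, φ s (DL s g) := by
  classical
  have key : ∀ {S : Finset (ℤ × ℤ)}, Supp S g →
      ∀ T, ∑ s ∈ S, φ s (DL s g) = ∑ s ∈ S ∪ T, φ s (DL s g) := fun {S} hS T =>
    Finset.sum_subset Finset.subset_union_left fun s _ hs => by rw [hS s hs, hφ]
  rw [key hS T, key hT S, Finset.union_comm]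

/-- The first order operator `Σ_s c(s) x_{n+s} ∂_s`. -/
noncomputable def E1 (c : ℤ × ℤ → ℂ) (n : ℤ × ℤ) : NN m →ₗ[ℂ] NN m where
  toFun g := ∑ s ∈ nvars m g, c s • XL (n + s) (DL s g)
  map_add' a b := by
    have ha := (supp_nvars a).mono (Finset.subset_union_left (s₂ := nvars m b))
    have hb := (supp_nvars b).mono (Finset.subset_union_right (s₁ := nvars m a))
    have e := fun {S T : Finset (ℤ × ℤ)} {g : NN m} (hS : Supp S g) (hT : Supp T g) =>
      sum_eq_of_supp hS hT (fun s g => c s • XL (n + s) g) (by simp)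
    rw [e (supp_nvars (a + b)) (ha.add hb), e (supp_nvars a) ha, e (supp_nvars b) hb,
      ← Finset.sum_add_distrib]
    simp
  map_smul' z a := by
    have e := fun {S T : Finset (ℤ × ℤ)} {g : NN m} (hS : Supp S g) (hT : Supp T g) =>
      sum_eq_of_supp hS hT (fun s g => c s • XL (n + s) g) (by simp)
    rw [e (supp_nvars (z • a)) ((supp_nvars a).smul z), RingHom.id_apply, Finset.smul_sum]
    exact Finset.sum_congr rfl fun s _ => by rw [map_smul, map_smul, smul_comm]

theorem E1_eq {S : Finset (ℤ × ℤ)} {g : NN m} (hS : Supp S g) (c : ℤ × ℤ → ℂ) (n : ℤ × ℤ) :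
    E1 c n g = ∑ s ∈ S, c s • XL (n + s) (DL s g) :=
  sum_eq_of_supp (supp_nvars g) hS (fun s g => c s • XL (n + s) g) (by simp)

theorem sum_sum_eq_of_supp {S T : Finset (ℤ × ℤ)} {g : NN m} (hS : Supp S g) (hT : Supp T g)
    (c : ℤ × ℤ → ℤ × ℤ → ℂ) (n : ℤ × ℤ) :
    ∑ s ∈ S, ∑ r ∈ S, c s r • XL (n + s + r) (DL s (DL r g)) =
      ∑ s ∈ T, ∑ r ∈ T, c s r • XL (n + s + r) (DL s (DL r g)) := by
  rw [Finset.sum_congr rfl fun s _ =>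
    sum_eq_of_supp hS hT (fun r g => c s r • XL (n + s + r) (DL s g)) (by simp)]
  rw [Finset.sum_comm, Finset.sum_congr rfl fun r _ =>
    sum_eq_of_supp (hS.deriv r) (hT.deriv r) (fun s g => c s r • XL (n + s + r) g) (by simp)]
  rw [Finset.sum_comm]

/-- The second order operator `Σ_{s,r} c(s,r) x_{n+s+r} ∂_s ∂_r`. -/
noncomputable def E2 (c : ℤ × ℤ → ℤ × ℤ → ℂ) (n : ℤ × ℤ) : NN m →ₗ[ℂ] NN m where
  toFun g := ∑ s ∈ nvars m g, ∑ r ∈ nvars m g, c s r • XL (n + s + r) (DL s (DL r g))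
  map_add' a b := by
    have ha := (supp_nvars a).mono (Finset.subset_union_left (s₂ := nvars m b))
    have hb := (supp_nvars b).mono (Finset.subset_union_right (s₁ := nvars m a))
    rw [sum_sum_eq_of_supp (supp_nvars (a + b)) (ha.add hb),
      sum_sum_eq_of_supp (supp_nvars a) ha, sum_sum_eq_of_supp (supp_nvars b) hb]
    simp [Finset.sum_add_distrib]
  map_smul' z a := by
    rw [sum_sum_eq_of_supp (supp_nvars (z • a)) ((supp_nvars a).smul z), RingHom.id_apply,
      Finset.smul_sum]
    refine Finset.sum_congr rfl fun s _ => ?_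
    rw [Finset.smul_sum]
    exact Finset.sum_congr rfl fun r _ => by rw [map_smul, map_smul, map_smul, smul_comm]

theorem E2_eq {S : Finset (ℤ × ℤ)} {g : NN m} (hS : Supp S g) (c : ℤ × ℤ → ℤ × ℤ → ℂ)
    (n : ℤ × ℤ) :
    E2 c n g = ∑ s ∈ S, ∑ r ∈ S, c s r • XL (n + s + r) (DL s (DL r g)) :=
  sum_sum_eq_of_supp (supp_nvars g) hS c n

theorem exists_supp (g : NN m) (T : Finset (ℤ × ℤ)) : ∃ S, T ⊆ S ∧ Supp S g :=
  ⟨T ∪ nvars m g, Finset.subset_union_left, (supp_nvars g).mono Finset.subset_union_right⟩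

theorem E1_XL (c : ℤ × ℤ → ℂ) (n k : ℤ × ℤ) (g : NN m) :
    E1 c n (XL k g) = XL k (E1 c n g) + c k • XL (n + k) g := by
  obtain ⟨S, hk, hS⟩ := exists_supp g {k}
  have hk : k ∈ S := hk (by simp)
  rw [E1_eq (hS.mul hk), E1_eq hS, map_sum]
  simp only [DL_XL, map_add, smul_add, Finset.sum_add_distrib, map_smul, XL_comm k]
  congr 1
  rw [Finset.sum_eq_single k (fun b _ hb => by simp [hb]) (fun h => absurd hk h)]
  simp

theorem E2_XL (c : ℤ × ℤ → ℤ × ℤ → ℂ) (n k : ℤ × ℤ) (g : NN m) :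
    E2 c n (XL k g) = XL k (E2 c n g) + E1 (fun s => c k s) (n + k) g
      + E1 (fun s => c s k) (n + k) g := by
  obtain ⟨S, hk, hS⟩ := exists_supp g {k}
  have hk : k ∈ S := hk (by simp)
  rw [E2_eq (hS.mul hk), E2_eq hS, E1_eq hS, E1_eq hS, map_sum]
  simp only [DL_XL, map_add, smul_add, Finset.sum_add_distrib, map_sum, map_smul, XL_comm k]
  congr 1
  · congr 1
    rw [Finset.sum_eq_single k (fun b _ hb => by simp [hb]) (fun h => absurd hk h)]
    simp
  · refine Finset.sum_congr rfl fun s _ => ?_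
    rw [Finset.sum_eq_single k (fun b _ hb => by simp [hb]) (fun h => absurd hk h)]
    simp [add_right_comm]

theorem DL_E1 (c : ℤ × ℤ → ℂ) (n k : ℤ × ℤ) (g : NN m) :
    DL k (E1 c n g) = E1 c n (DL k g) + c (k - n) • DL (k - n) g := by
  obtain ⟨S, hk, hS⟩ := exists_supp g {k - n}
  have hk : k - n ∈ S := hk (by simp)
  rw [E1_eq hS, E1_eq (hS.deriv k), map_sum]
  simp only [DL_XL, smul_add, Finset.sum_add_distrib, map_smul, DL_comm k]
  congr 1
  rw [Finset.sum_eq_single (k - n)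
    (fun b _ hb => by rw [if_neg (fun h => hb (by rw [h]; abel)), smul_zero])
    (fun h => absurd hk h)]
  simp

theorem DL_E2 {S : Finset (ℤ × ℤ)} {g : NN m} (hS : Supp S g) (c : ℤ × ℤ → ℤ × ℤ → ℂ)
    (n k : ℤ × ℤ) :
    DL k (E2 c n g) = E2 c n (DL k g)
      + ∑ s ∈ S, ∑ r ∈ S, if k = n + s + r then c s r • DL s (DL r g) else 0 := by
  rw [E2_eq hS, E2_eq (hS.deriv k), map_sum]
  simp only [DL_XL, smul_add, Finset.sum_add_distrib, map_smul, map_sum, DL_comm k,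
    smul_ite, smul_zero]

theorem E2_E1 (c : ℤ × ℤ → ℤ × ℤ → ℂ) (c' : ℤ × ℤ → ℂ) (n n' : ℤ × ℤ) (g : NN m) :
    E2 c n (E1 c' n' g) = E1 c' n' (E2 c n g) +
      E2 (fun s r => c' s * c (n' + s) r + c' r * c s (n' + r) - c' (n + s + r) * c s r)
        (n + n') g := by
  have hS := supp_nvars g
  set S := nvars m g
  rw [E1_eq hS, E2_eq hS c, E2_eq hS]
  simp only [map_sum, map_smul, E2_XL, E1_XL, E2_eq (hS.deriv _), E1_eq (hS.deriv _),
    E1_eq ((hS.deriv _).deriv _)]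
  simp only [Finset.smul_sum, smul_add, Finset.sum_add_distrib, smul_smul, add_smul, sub_smul,
    Finset.sum_sub_distrib]
  have h1 : ∑ a ∈ S, ∑ s ∈ S, ∑ r ∈ S,
        (c' a * c s r) • XL (n' + a) (XL (n + s + r) (DL s (DL r (DL a g)))) =
      ∑ s ∈ S, ∑ r ∈ S, ∑ a ∈ S,
        (c s r * c' a) • XL (n + s + r) (XL (n' + a) (DL a (DL s (DL r g)))) := by
    rw [Finset.sum_comm]
    refine Finset.sum_congr rfl fun s _ => ?_
    rw [Finset.sum_comm]
    refine Finset.sum_congr rfl fun r _ => Finset.sum_congr rfl fun a _ => ?_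
    rw [mul_comm, XL_comm, DL_comm r a, DL_comm s a]
  have h2 : ∑ a ∈ S, ∑ r ∈ S, (c' a * c (n' + a) r) • XL (n + (n' + a) + r) (DL r (DL a g)) =
      ∑ s ∈ S, ∑ r ∈ S, (c' s * c (n' + s) r) • XL (n + n' + s + r) (DL s (DL r g)) := by
    refine Finset.sum_congr rfl fun a _ => Finset.sum_congr rfl fun r _ => ?_
    rw [DL_comm r a, ← add_assoc n n' a]
  have h3 : ∑ a ∈ S, ∑ s ∈ S, (c' a * c s (n' + a)) • XL (n + (n' + a) + s) (DL s (DL a g)) =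
      ∑ s ∈ S, ∑ r ∈ S, (c' r * c s (n' + r)) • XL (n + n' + s + r) (DL s (DL r g)) := by
    rw [Finset.sum_comm]
    refine Finset.sum_congr rfl fun s _ => Finset.sum_congr rfl fun a _ => ?_
    rw [show n + (n' + a) + s = n + n' + s + a by abel]
  have h4 : ∑ s ∈ S, ∑ r ∈ S, (c s r * c' (n + s + r)) • XL (n' + (n + s + r)) (DL s (DL r g)) =
      ∑ s ∈ S, ∑ r ∈ S, (c' (n + s + r) * c s r) • XL (n + n' + s + r) (DL s (DL r g)) := by
    refine Finset.sum_congr rfl fun s _ => Finset.sum_congr rfl fun r _ => ?_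
    rw [mul_comm, show n' + (n + s + r) = n + n' + s + r by abel]
  rw [h1, h2, h3, h4]
  abel

theorem E2_E2 (c c' : ℤ × ℤ → ℤ × ℤ → ℂ) (n n' : ℤ × ℤ) {S : Finset (ℤ × ℤ)} {g : NN m}
    (hS : Supp S g) :
    E2 c n (E2 c' n' g) =
      (∑ a ∈ S, ∑ b ∈ S, ∑ s ∈ S, ∑ r ∈ S, (c' a b * c s r) •
        XL (n' + a + b) (XL (n + s + r) (DL s (DL r (DL a (DL b g)))))) +
      ∑ a ∈ S, ∑ b ∈ S, ∑ s ∈ S, (c' a b * (c (n' + a + b) s + c s (n' + a + b))) •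
        XL (n + n' + a + b + s) (DL s (DL a (DL b g))) := by
  rw [E2_eq hS c']
  simp only [map_sum, map_smul, E2_XL, E2_eq ((hS.deriv _).deriv _), E1_eq ((hS.deriv _).deriv _)]
  simp only [Finset.smul_sum, smul_add, Finset.sum_add_distrib, smul_smul, mul_add, add_smul,
    add_assoc]

theorem E1_smul (a : ℂ) (c : ℤ × ℤ → ℂ) (n : ℤ × ℤ) (g : NN m) :
    E1 (fun s => a * c s) n g = a • E1 c n g := by
  simp only [E1_eq (supp_nvars g), Finset.smul_sum, smul_smul]

theorem E2_smul (a : ℂ) (c : ℤ × ℤ → ℤ × ℤ → ℂ) (n : ℤ × ℤ) (g : NN m) :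
    E2 (fun s r => a * c s r) n g = a • E2 c n g := by
  simp only [E2_eq (supp_nvars g), Finset.smul_sum, smul_smul]

/-- The coefficient of `x_{n+s+r} ∂_s ∂_r` in `E12(n)`. -/
noncomputable def sig (q : ℂ) (n s r : ℤ × ℤ) : ℂ := q ^ (n.2 * r.1 + s.2 * n.1 + s.2 * r.1)

/-- `E12(n)` as a linear map. -/
noncomputable def E12 (q μ : ℂ) (n : ℤ × ℤ) : NN m →ₗ[ℂ] NN m :=
  (q ^ (-(n.1 * n.2)) * μ) • DL (-n) - E2 (sig q n) n

/-- `E22(n)` as a linear map. -/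
noncomputable def E22 (q : ℂ) (n : ℤ × ℤ) : NN m →ₗ[ℂ] NN m := E1 (fun s => q ^ (s.1 * n.2)) n

/-- `δ_{n,0} μ - E11(n)` as a linear map. -/
noncomputable def E11 (q : ℂ) (n : ℤ × ℤ) : NN m →ₗ[ℂ] NN m := E1 (fun s => q ^ (s.2 * n.1)) n

/-- The Euler operator `Σ_s x_s ∂_s`. -/
noncomputable def Eul : NN m →ₗ[ℂ] NN m := E1 (fun _ => 1) 0

theorem E12N_eq (q μ : ℂ) (n : ℤ × ℤ) (g : NN m) : E12N q μ m n g = E12 q μ n g := by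
  rw [E12, LinearMap.sub_apply, LinearMap.smul_apply, mul_smul]
  rfl

theorem E11N_eq (q μ : ℂ) (n : ℤ × ℤ) (g : NN m) :
    E11N q μ m n g = (if n = 0 then μ • g else 0) - E11 q n g := rfl

theorem D1N_eq (g : NN m) : D1N m g = E1 (fun s => (s.1 : ℂ)) 0 g := by
  rw [E1_eq (supp_nvars g)]
  simp only [zero_add]
  rfl

theorem D2N_eq (g : NN m) : D2N m g = E1 (fun s => (s.2 : ℂ)) 0 g := by
  rw [E1_eq (supp_nvars g)]
  simp only [zero_add]
  rfl

theorem E22_zero (q : ℂ) : (E22 q 0 : NN m →ₗ[ℂ] NN m) = Eul := by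
  simp [E22, Eul]

theorem E11_zero (q : ℂ) : (E11 q 0 : NN m →ₗ[ℂ] NN m) = Eul := by
  simp [E11, Eul]

theorem E12_apply (q μ : ℂ) (n : ℤ × ℤ) (g : NN m) :
    E12 q μ n g = (q ^ (-(n.1 * n.2)) * μ) • DL (-n) g - E2 (sig q n) n g := rfl

theorem E12_XL {q : ℂ} (hq : q ≠ 0) (μ : ℂ) (n k : ℤ × ℤ) (g : NN m) :
    E12 q μ n (XL k g) = XL k (E12 q μ n g) + (if -n = k then (q ^ (-(n.1 * n.2)) * μ) • g else 0)
      - q ^ (k.2 * n.1) • E22 q (n + k) g - q ^ (n.2 * k.1) • E11 q (n + k) g := by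
  have h1 : E1 (fun s => sig q n k s) (n + k) g = q ^ (k.2 * n.1) • E22 q (n + k) g := by
    rw [E22, ← E1_smul]
    congr 2; funext s
    rw [sig, ← zpow_add₀ hq]; congr 1; simp; ring
  have h2 : E1 (fun s => sig q n s k) (n + k) g = q ^ (n.2 * k.1) • E11 q (n + k) g := by
    rw [E11, ← E1_smul]
    congr 2; funext s
    rw [sig, ← zpow_add₀ hq]; congr 1; simp; ring
  simp only [E12_apply, E2_XL, DL_XL, h1, h2, map_sub, map_smul, smul_add, smul_ite, smul_zero]
  abel

theorem E12_E22 {q : ℂ} (hq : q ≠ 0) (μ : ℂ) (n k : ℤ × ℤ) (g : NN m) :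
    E12 q μ n (E22 q k g) = E22 q k (E12 q μ n g) + q ^ (n.2 * k.1) • E12 q μ (n + k) g := by
  have h1 : ((q ^ (-(n.1 * n.2)) * μ) * q ^ ((-n - k).1 * k.2)) =
      q ^ (n.2 * k.1) * (q ^ (-((n + k).1 * (n + k).2)) * μ) := by
    rw [mul_right_comm, ← mul_assoc, ← zpow_add₀ hq, ← zpow_add₀ hq]
    congr 2; simp; ring
  have h2 : (fun s r => q ^ (s.1 * k.2) * sig q n (k + s) r + q ^ (r.1 * k.2) * sig q n s (k + r)
      - q ^ ((n + s + r).1 * k.2) * sig q n s r) =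
      fun s r => q ^ (n.2 * k.1) * sig q (n + k) s r := by
    funext s r
    simp only [sig, ← zpow_add₀ hq]
    rw [add_comm, add_sub_assoc, sub_eq_zero_of_eq, add_zero]
    · congr 1; simp; ring
    · congr 1; simp; ring
  simp only [E12_apply, E22, E2_E1, DL_E1, h2, E2_smul, map_sub, map_smul, smul_add, smul_sub,
    smul_smul, h1]
  rw [show -n - k = -(n + k) by abel]
  abel

theorem E12_E11 {q : ℂ} (hq : q ≠ 0) (μ : ℂ) (n k : ℤ × ℤ) (g : NN m) :
    E12 q μ n (E11 q k g) = E11 q k (E12 q μ n g) + q ^ (n.1 * k.2) • E12 q μ (n + k) g := by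
  have h1 : ((q ^ (-(n.1 * n.2)) * μ) * q ^ ((-n - k).2 * k.1)) =
      q ^ (n.1 * k.2) * (q ^ (-((n + k).1 * (n + k).2)) * μ) := by
    rw [mul_right_comm, ← mul_assoc, ← zpow_add₀ hq, ← zpow_add₀ hq]
    congr 2; simp; ring
  have h2 : (fun s r => q ^ (s.2 * k.1) * sig q n (k + s) r + q ^ (r.2 * k.1) * sig q n s (k + r)
      - q ^ ((n + s + r).2 * k.1) * sig q n s r) =
      fun s r => q ^ (n.1 * k.2) * sig q (n + k) s r := by
    funext s r
    simp only [sig, ← zpow_add₀ hq]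
    rw [add_sub_assoc, sub_eq_zero_of_eq, add_zero]
    · congr 1; simp; ring
    · congr 1; simp; ring
  simp only [E12_apply, E11, E2_E1, DL_E1, h2, E2_smul, map_sub, map_smul, smul_add, smul_sub,
    smul_smul, h1]
  rw [show -n - k = -(n + k) by abel]
  abel

theorem E12_weight (q μ : ℂ) (n : ℤ × ℤ) (w : ℤ × ℤ → ℂ) (a : ℂ)
    (hw : ∀ s r, w s + w r - w (n + s + r) = a) (hn : w (-n) = a) (g : NN m) :
    E12 q μ n (E1 w 0 g) = E1 w 0 (E12 q μ n g) + a • E12 q μ n g := by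
  have h2 : (fun s r => w s * sig q n (0 + s) r + w r * sig q n s (0 + r)
      - w (n + s + r) * sig q n s r) = fun s r => a * sig q n s r := by
    funext s r
    rw [zero_add, zero_add, ← add_mul, ← sub_mul, hw]
  simp only [E12_apply, E2_E1, DL_E1, h2, map_sub, map_smul, smul_add, smul_sub,
    sub_zero, hn, add_zero]
  rw [E2_smul, smul_comm a]
  abel

theorem E12_Eul (q μ : ℂ) (n : ℤ × ℤ) (g : NN m) :
    E12 q μ n (Eul g) = Eul (E12 q μ n g) + E12 q μ n g := by
  rw [Eul, E12_weight q μ n _ 1 (by simp) rfl, one_smul]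

theorem Eul_E12 (q μ : ℂ) (n : ℤ × ℤ) (g : NN m) :
    Eul (E12 q μ n g) = E12 q μ n (Eul g) - E12 q μ n g := by
  rw [E12_Eul, add_sub_cancel_right]

theorem Eul_XL (k : ℤ × ℤ) (g : NN m) : Eul (XL k g) = XL k (Eul g) + XL k g := by
  rw [Eul, E1_XL, one_smul, zero_add]

theorem cubic_symm {q : ℂ} (hq : q ≠ 0) (n k : ℤ × ℤ) (S : Finset (ℤ × ℤ)) (g : NN m) :
    ∑ a ∈ S, ∑ b ∈ S, ∑ s ∈ S, (sig q k a b * sig q n s (k + a + b)) •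
        XL (n + k + a + b + s) (DL s (DL a (DL b g))) =
      ∑ a ∈ S, ∑ b ∈ S, ∑ s ∈ S, (sig q n a b * sig q k (n + a + b) s) •
        XL (k + n + a + b + s) (DL s (DL a (DL b g))) := by
  rw [Finset.sum_congr rfl fun a _ => Finset.sum_comm, Finset.sum_comm]
  refine Finset.sum_congr rfl fun a _ => Finset.sum_congr rfl fun b _ =>
    Finset.sum_congr rfl fun s _ => ?_
  rw [DL_comm s a, DL_comm s b, show n + k + b + s + a = k + n + a + b + s by abel]
  congr 1
  simp only [sig, ← zpow_add₀ hq]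
  congr 1; simp; ring

theorem quartic_symm (c c' : ℤ × ℤ → ℤ × ℤ → ℂ) (n k : ℤ × ℤ) (S : Finset (ℤ × ℤ)) (g : NN m) :
    ∑ a ∈ S, ∑ b ∈ S, ∑ s ∈ S, ∑ r ∈ S, (c' a b * c s r) •
        XL (k + a + b) (XL (n + s + r) (DL s (DL r (DL a (DL b g))))) =
      ∑ a ∈ S, ∑ b ∈ S, ∑ s ∈ S, ∑ r ∈ S, (c a b * c' s r) •
        XL (n + a + b) (XL (k + s + r) (DL s (DL r (DL a (DL b g))))) := by
  rw [Finset.sum_congr rfl fun a _ => Finset.sum_comm, Finset.sum_comm]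
  refine Finset.sum_congr rfl fun s _ => ?_
  rw [Finset.sum_congr rfl fun a _ => Finset.sum_comm, Finset.sum_comm]
  refine Finset.sum_congr rfl fun r _ => Finset.sum_congr rfl fun a _ =>
    Finset.sum_congr rfl fun b _ => ?_
  rw [mul_comm, XL_comm, DL_comm r a, DL_comm r b, DL_comm s a, DL_comm s b]

theorem mixed_symm {q : ℂ} (hq : q ≠ 0) (n k : ℤ × ℤ) (S : Finset (ℤ × ℤ)) (g : NN m) :
    q ^ (-(n.1 * n.2)) •
      (∑ s ∈ S, ∑ r ∈ S, if -n = k + s + r then sig q k s r • DL s (DL r g) else 0) =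
      q ^ (-(k.1 * k.2)) •
      (∑ s ∈ S, ∑ r ∈ S, if -k = n + s + r then sig q n s r • DL s (DL r g) else 0) := by
  rw [Finset.sum_comm, Finset.smul_sum, Finset.smul_sum]
  refine Finset.sum_congr rfl fun s _ => ?_
  rw [Finset.smul_sum, Finset.smul_sum]
  refine Finset.sum_congr rfl fun r _ => ?_
  have hiff : -n = k + r + s ↔ -k = n + s + r := by
    rw [neg_eq_iff_add_eq_zero, neg_eq_iff_add_eq_zero,
      show n + (k + r + s) = k + (n + s + r) by abel]
  by_cases h : -n = k + r + s
  · rw [if_pos h, if_pos (hiff.1 h), smul_smul, smul_smul, DL_comm]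
    simp only [sig, ← zpow_add₀ hq]
    congr 2
    have h1 : n.1 = -(k.1 + r.1 + s.1) := by rw [← neg_neg n, h]; simp
    have h2 : n.2 = -(k.2 + r.2 + s.2) := by rw [← neg_neg n, h]; simp
    rw [h1, h2]
    ring
  · rw [if_neg h, if_neg (fun h' => h (hiff.2 h')), smul_zero, smul_zero]

theorem E12_comm {q : ℂ} (hq : q ≠ 0) (μ : ℂ) (n k : ℤ × ℤ) (g : NN m) :
    E12 q μ n (E12 q μ k g) = E12 q μ k (E12 q μ n g) := by
  have hS := supp_nvars g
  simp only [E12_apply, map_sub, map_smul, smul_sub]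
  rw [E2_E2 _ _ n k hS, E2_E2 _ _ k n hS, quartic_symm (sig q n) (sig q k), DL_E2 hS, DL_E2 hS,
    DL_comm (-n) (-k)]
  simp only [mul_add, add_smul, Finset.sum_add_distrib]
  rw [cubic_symm hq n k, cubic_symm hq k n]
  simp only [smul_add, mul_comm _ μ, mul_smul, mixed_symm hq n k]
  rw [smul_comm (q ^ (-(k.1 * k.2))) μ, smul_comm (q ^ (-(k.1 * k.2))) (q ^ (-(n.1 * n.2))),
    smul_comm (q ^ (-(n.1 * n.2))) μ]
  have rearrange : ∀ a b c d e u v : NN m,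
      a - b - ((c + d) - (e + (u + v))) = a - c - ((b + d) - (e + (v + u))) := by
    intros; abel
  exact rearrange _ _ _ _ _ _ _

theorem XL_mem_P (k : ℤ × ℤ) {g : NN m} (hg : g ∈ PinN m) : XL k g ∈ PinN m := by
  intro j hj
  rw [XL_apply]
  split_ifs
  · exact hg _ (by omega)
  · rw [hg _ hj, mul_zero]

theorem DL_mem_P (s : ℤ × ℤ) {g : NN m} (hg : g ∈ PinN m) : DL s g ∈ PinN m := by
  intro j hj
  rw [DL_apply]
  split_ifs
  · rcases eq_or_ne j (-1) with rfl | hj'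
    · simp
    · rw [hg _ (by omega), smul_zero]
  · rw [hg _ hj, map_zero]

theorem E1_mem_P (c : ℤ × ℤ → ℂ) (n : ℤ × ℤ) {g : NN m} (hg : g ∈ PinN m) :
    E1 c n g ∈ PinN m :=
  Submodule.sum_mem _ fun _ _ => Submodule.smul_mem _ _ (XL_mem_P _ (DL_mem_P _ hg))

theorem E2_mem_P (c : ℤ × ℤ → ℤ × ℤ → ℂ) (n : ℤ × ℤ) {g : NN m} (hg : g ∈ PinN m) :
    E2 c n g ∈ PinN m :=
  Submodule.sum_mem _ fun _ _ => Submodule.sum_mem _ fun _ _ =>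
    Submodule.smul_mem _ _ (XL_mem_P _ (DL_mem_P _ (DL_mem_P _ hg)))

theorem E12_mem_P (q μ : ℂ) (n : ℤ × ℤ) {g : NN m} (hg : g ∈ PinN m) :
    E12 q μ n g ∈ PinN m :=
  Submodule.sub_mem _ (Submodule.smul_mem _ _ (DL_mem_P _ hg)) (E2_mem_P _ _ hg)

theorem Eul_DL (k : ℤ × ℤ) (g : NN m) : Eul (DL k g) = DL k (Eul g) - DL k g := by
  rw [Eul, DL_E1, one_smul, sub_zero, add_sub_cancel_right]

theorem Eul_E1 (c : ℤ × ℤ → ℂ) (n : ℤ × ℤ) (g : NN m) :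
    Eul (E1 c n g) = E1 c n (Eul g) := by
  obtain ⟨S, hS, hg⟩ := exists_supp g (nvars m (Eul g))
  rw [E1_eq hg, E1_eq ((supp_nvars (Eul g)).mono hS), map_sum]
  simp only [map_smul, Eul_XL, Eul_DL, map_sub, sub_add_cancel]

theorem XL_single (k : ℤ × ℤ) (h : k ≠ m) (j : ℤ) (p : MvPolynomial (NVar m) ℂ) :
    XL k (Finsupp.single j p : NN m) = Finsupp.single j (X ⟨k, h⟩ * p) := by
  ext1 i
  rw [XL_apply, dif_neg h]
  rcases eq_or_ne i j with rfl | hij <;> simp [*]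

theorem XL_single_self (j : ℤ) (p : MvPolynomial (NVar m) ℂ) :
    XL m (Finsupp.single j p : NN m) = Finsupp.single (j + 1) p := by
  ext1 i
  rw [XL_apply, dif_pos rfl]
  simp only [Finsupp.single_apply]
  congr 1
  rw [eq_iff_iff]; omega

theorem DL_single (s : ℤ × ℤ) (h : s ≠ m) (j : ℤ) (p : MvPolynomial (NVar m) ℂ) :
    DL s (Finsupp.single j p : NN m) = Finsupp.single j (pderiv ⟨s, h⟩ p) := by
  ext1 i
  rw [DL_apply, dif_neg h]
  rcases eq_or_ne i j with rfl | hij <;> simp [*]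

theorem DL_single_self (j : ℤ) (p : MvPolynomial (NVar m) ℂ) :
    DL m (Finsupp.single j p : NN m) = Finsupp.single (j - 1) ((j : ℂ) • p) := by
  ext1 i
  rw [DL_apply, dif_pos rfl]
  rcases eq_or_ne i (j - 1) with rfl | hij
  · simp
  · rw [Finsupp.single_eq_of_ne (by omega), Finsupp.single_eq_of_ne hij, smul_zero]

theorem supp_single_C (j : ℤ) (a : ℂ) : Supp {m} (Finsupp.single j (C a) : NN m) := by
  intro s hs
  rw [DL_single s (by simpa using hs), pderiv_C, Finsupp.single_zero]

theorem Eul_single_C (j : ℤ) (a : ℂ) :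
    Eul (Finsupp.single j (C a) : NN m) = (j : ℂ) • Finsupp.single j (C a) := by
  rw [Eul, E1_eq (supp_single_C j a), Finset.sum_singleton, zero_add, DL_single_self,
    XL_single_self, sub_add_cancel, one_smul, Finsupp.smul_single]

theorem coeff_Eul (g : NN m) (k : ℤ) (σ : NVar m →₀ ℕ) :
    coeff σ (Eul g k) = (k + σ.degree) * coeff σ (g k) := by
  induction g using Finsupp.induction_linear with
  | zero => simp
  | add f g hf hg => simp only [map_add, Finsupp.add_apply, coeff_add, hf, hg, mul_add]
  | single j p =>
    induction p using MvPolynomial.induction_on generalizing σ with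
    | C a =>
      rw [Eul_single_C, Finsupp.smul_apply, coeff_smul, smul_eq_mul]
      rcases eq_or_ne k j with rfl | h
      · rw [Finsupp.single_eq_same, coeff_C]
        split_ifs with h
        · simp [← h]
        · simp
      · simp [h]
    | add p p' hp hp' =>
      simp only [Finsupp.single_add, map_add, Finsupp.add_apply, coeff_add, hp, hp', mul_add]
    | mul_X p i hp =>
      obtain ⟨i, hi⟩ := i
      rw [mul_comm, ← XL_single i hi, Eul_XL, Finsupp.add_apply]
      simp only [XL_apply, dif_neg hi]
      rw [coeff_add, coeff_X_mul', coeff_X_mul']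
      split_ifs with h
      · have hd : (σ - Finsupp.single (⟨i, hi⟩ : NVar m) 1).degree + 1 = σ.degree := by
          conv_rhs => rw [← tsub_add_cancel_of_le (a := Finsupp.single (⟨i, hi⟩ : NVar m) 1) (b := σ)
            (by simpa [Nat.one_le_iff_ne_zero] using h)]
          simp [Finsupp.degree_single]
        rw [hp, ← hd]
        push_cast
        ring
      · simp

/-- A multiple of `E12(-m)` normalized to lower the exponent of `x_m`. -/
noncomputable def F (m : ℤ × ℤ) (q μ : ℂ) : NN m →ₗ[ℂ] NN m := q ^ (m.1 * m.2) • E12 q μ (-m)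

theorem F_apply (q μ : ℂ) (g : NN m) : F m q μ g = q ^ (m.1 * m.2) • E12 q μ (-m) g := rfl

theorem F_mem_P (q μ : ℂ) {g : NN m} (hg : g ∈ PinN m) : F m q μ g ∈ PinN m :=
  Submodule.smul_mem _ _ (E12_mem_P _ _ _ hg)

theorem XL_F {q : ℂ} (hq : q ≠ 0) (μ : ℂ) (g : NN m) :
    XL m (F m q μ g) = F m q μ (XL m g) - (μ • g - (2 : ℂ) • Eul g) := by
  rw [F_apply, F_apply, E12_XL hq, if_pos (neg_neg m), neg_add_cancel, E22_zero, E11_zero]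
  simp only [Prod.fst_neg, Prod.snd_neg, mul_neg, neg_mul, neg_neg, map_smul, smul_sub,
    smul_add, smul_smul, ← mul_assoc, mul_comm m.2]
  rw [zpow_neg, mul_inv_cancel₀ (zpow_ne_zero _ hq), one_mul]
  module

theorem Eul_F (q μ : ℂ) (g : NN m) : Eul (F m q μ g) = F m q μ (Eul g) - F m q μ g := by
  rw [F_apply, map_smul, Eul_E12, F_apply, smul_sub]

/-- The commutator of `x_m` and `E12(n)`. -/
noncomputable def H (m : ℤ × ℤ) (q : ℂ) (n : ℤ × ℤ) : NN m →ₗ[ℂ] NN m :=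
  q ^ (m.2 * n.1) • E22 q (n + m) + q ^ (n.2 * m.1) • E11 q (n + m)

theorem H_apply (q : ℂ) (n : ℤ × ℤ) (g : NN m) : H m q n g =
    q ^ (m.2 * n.1) • E22 q (n + m) g + q ^ (n.2 * m.1) • E11 q (n + m) g := rfl

theorem XL_E12 {q : ℂ} (hq : q ≠ 0) (μ : ℂ) {n : ℤ × ℤ} (hn : n ≠ -m) (g : NN m) :
    XL m (E12 q μ n g) = E12 q μ n (XL m g) + H m q n g := by
  rw [E12_XL hq, if_neg (fun h => hn (by rw [← h, neg_neg])), H_apply]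
  abel

theorem XL_H {q : ℂ} (hq : q ≠ 0) (n : ℤ × ℤ) (g : NN m) :
    XL m (H m q n g) = H m q n (XL m g) - (2 * sig q n m m) • XL (n + m + m) g := by
  have h1 : q ^ (m.2 * n.1) * q ^ (m.1 * (n + m).2) = sig q n m m := by
    rw [sig, ← zpow_add₀ hq]; congr 1; simp; ring
  have h2 : q ^ (n.2 * m.1) * q ^ (m.2 * (n + m).1) = sig q n m m := by
    rw [sig, ← zpow_add₀ hq]; congr 1; simp; ring
  rw [H_apply, H_apply, E22, E11, E1_XL, E1_XL]
  simp only [map_add, map_smul, smul_add, smul_smul, h1, h2]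
  module

theorem Eul_H (q : ℂ) (n : ℤ × ℤ) (g : NN m) : Eul (H m q n g) = H m q n (Eul g) := by
  rw [H_apply, H_apply, map_add, map_smul, map_smul, E22, E11, Eul_E1, Eul_E1]

/-- The lowering operator on vectors annihilated by `x_m` modulo `P`. -/
noncomputable def Z (m : ℤ × ℤ) (q μ κ : ℂ) (n : ℤ × ℤ) : NN m →ₗ[ℂ] NN m :=
  (κ * (κ + 1)) • E12 q μ n + (κ + 1) • (H m q n ∘ₗ F m q μ)
    - sig q n m m • (XL (n + m + m) ∘ₗ F m q μ ∘ₗ F m q μ)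

theorem Z_apply (q μ κ : ℂ) (n : ℤ × ℤ) (g : NN m) : Z m q μ κ n g =
    (κ * (κ + 1)) • E12 q μ n g + (κ + 1) • H m q n (F m q μ g)
    - sig q n m m • XL (n + m + m) (F m q μ (F m q μ g)) := rfl

theorem XL_Z {q : ℂ} (hq : q ≠ 0) (μ ε : ℂ) {n : ℤ × ℤ} (hn : n ≠ -m) {g : NN m}
    (hg : Eul g = ε • g) :
    XL m (Z m q μ (μ - 2 * ε) n g) = Z m q μ (μ - 2 * ε) n (XL m g) := by
  simp only [Z_apply, map_add, map_sub, map_smul, XL_comm m (n + m + m), XL_E12 hq μ hn,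
    XL_H hq, XL_F hq, Eul_F, hg]
  module

theorem Eul_Z (q μ κ ε : ℂ) (n : ℤ × ℤ) {g : NN m} (hg : Eul g = ε • g) :
    Eul (Z m q μ κ n g) = (ε - 1) • Z m q μ κ n g := by
  simp only [Z_apply, map_add, map_sub, map_smul, Eul_E12, Eul_H, Eul_XL, Eul_F, hg]
  module

theorem H_mem_P (q : ℂ) (n : ℤ × ℤ) {g : NN m} (hg : g ∈ PinN m) : H m q n g ∈ PinN m := by
  rw [H_apply]
  exact add_mem (Submodule.smul_mem _ _ (E1_mem_P _ _ hg))
    (Submodule.smul_mem _ _ (E1_mem_P _ _ hg))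

theorem Z_mem_P (q μ κ : ℂ) (n : ℤ × ℤ) {g : NN m} (hg : g ∈ PinN m) :
    Z m q μ κ n g ∈ PinN m := by
  rw [Z_apply]
  exact sub_mem (add_mem (Submodule.smul_mem _ _ (E12_mem_P _ _ _ hg))
    (Submodule.smul_mem _ _ (H_mem_P _ _ (F_mem_P _ _ hg))))
    (Submodule.smul_mem _ _ (XL_mem_P _ (F_mem_P _ _ (F_mem_P _ _ hg))))

theorem exp_sum_mem {V ι : Type*} [AddCommGroup V] [Module ℂ V] (P : Submodule ℂ V)
    (z : ι → ℂ) (hz : ∀ i, z i ≠ 0) (I : Finset ι) (g : ι → V) (K : ℕ)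
    (h : ∀ k ≥ K, ∑ i ∈ I, z i ^ k • g i ∈ P) (k : ℕ) : ∑ i ∈ I, z i ^ k • g i ∈ P := by
  classical
  induction I using Finset.induction_on generalizing g k with
  | empty => simp
  | insert a s ha ih =>
    have key : ∀ k, ∑ i ∈ insert a s, z i ^ (k + 1) • g i - z a • ∑ i ∈ insert a s, z i ^ k • g i
        = ∑ i ∈ s, z i ^ k • ((z i - z a) • g i) := fun k => by
      rw [Finset.sum_insert ha, Finset.sum_insert ha, smul_add, smul_smul, ← pow_succ',
        add_sub_add_left_eq_sub, Finset.smul_sum, ← Finset.sum_sub_distrib]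
      refine Finset.sum_congr rfl fun i _ => ?_
      rw [pow_succ]
      module
    have hs : ∀ k, ∑ i ∈ s, z i ^ k • ((z i - z a) • g i) ∈ P := fun k =>
      ih _ (fun j hj => by
        rw [← key]
        exact sub_mem (h _ (by omega)) (P.smul_mem _ (h _ hj))) k
    have desc : ∀ d k, K ≤ k + d → ∑ i ∈ insert a s, z i ^ k • g i ∈ P := by
      intro d
      induction d with
      | zero => exact fun k hk => h k hk
      | succ d ihd =>
        intro k hk
        have h1 := sub_mem (ihd (k + 1) (by omega)) (hs k)
        rw [← key, sub_sub_cancel] at h1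
        exact (P.smul_mem_iff (hz a)).1 h1
    exact desc K k (by omega)

/-- The sequences of elements of `N` spanned by `k ↦ z^k x_{p+(k,0)} g`. -/
noncomputable def Gen (m : ℤ × ℤ) : Submodule ℂ (ℕ → NN m) :=
  Submodule.span ℂ (Set.range fun (t : ℂˣ × (ℤ × ℤ) × NN m) (k : ℕ) =>
    (t.1 : ℂ) ^ k • XL (t.2.1 + ((k : ℤ), 0)) t.2.2)

theorem mem_Gen (a : ℂ) {z : ℂ} (hz : z ≠ 0) (p : ℤ × ℤ) (g : NN m) {b : ℕ → NN m}
    (hb : ∀ k, b k = (a * z ^ k) • XL (p + ((k : ℤ), 0)) g) : b ∈ Gen m := by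
  have : b = a • fun k : ℕ => z ^ k • XL (p + ((k : ℤ), 0)) g := by
    funext k
    rw [hb, mul_smul, Pi.smul_apply]
  rw [this]
  exact Submodule.smul_mem _ _ (Submodule.subset_span ⟨(Units.mk0 z hz, p, g), rfl⟩)

theorem eventually_DL_eq_zero (p : ℤ × ℤ) (g : NN m) :
    ∀ᶠ k : ℕ in Filter.atTop, DL (p + ((k : ℤ), 0)) g = 0 := by
  have hinj : Function.Injective fun k : ℕ => p + ((k : ℤ), (0 : ℤ)) := fun a b h => by
    simpa using h
  have := hinj.tendsto_cofinite.eventually (nvars m g).finite_toSet.compl_mem_cofinite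
  rw [Nat.cofinite_eq_atTop] at this
  exact this.mono fun k hk => supp_nvars g _ hk

theorem Gen_zero_mem {b : ℕ → NN m} (hb : b ∈ Gen m)
    (h : ∀ᶠ k in Filter.atTop, b k ∈ PinN m) : b 0 ∈ PinN m := by
  classical
  obtain ⟨c, hc⟩ := Finsupp.mem_span_range_iff_exists_finsupp.1 hb
  set I := c.support
  have hbk : ∀ k, b k = ∑ t ∈ I, XL (t.2.1 + ((k : ℤ), 0)) ((t.1 : ℂ) ^ k • c t • t.2.2) := by
    intro k
    rw [← hc, Finsupp.sum, Finset.sum_apply]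
    refine Finset.sum_congr rfl fun t _ => ?_
    rw [Pi.smul_apply, map_smul, map_smul, smul_comm]
  have key : ∀ p, ∑ t ∈ I with t.2.1 = p, (t.1 : ℂ) ^ 0 • c t • t.2.2 ∈ PinN m := by
    intro p
    have h0 : ∀ᶠ k : ℕ in Filter.atTop, ∀ t ∈ I, DL (p + ((k : ℤ), 0)) t.2.2 = 0 :=
      (Filter.eventually_all_finset I).2 fun t _ => eventually_DL_eq_zero _ _
    obtain ⟨K, hK⟩ := Filter.eventually_atTop.1 (h0.and h)
    refine exp_sum_mem (PinN m) (fun t : ℂˣ × (ℤ × ℤ) × NN m => (t.1 : ℂ)) (fun t => t.1.ne_zero)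
      _ _ K (fun k hk => ?_) 0
    obtain ⟨h1, h2⟩ := hK k hk
    have h3 := DL_mem_P (p + ((k : ℤ), 0)) h2
    rw [hbk, map_sum] at h3
    rw [Finset.sum_filter]
    convert h3 using 1
    refine Finset.sum_congr rfl fun t ht => ?_
    rw [DL_XL, map_smul, map_smul (DL _) (c t), h1 t ht, smul_zero, smul_zero, map_zero, zero_add]
    simp only [add_left_inj, eq_comm]
  rw [hbk, ← Finset.sum_fiberwise_of_maps_to (t := I.image fun t => t.2.1)
    (g := fun t => t.2.1) (fun t ht => Finset.mem_image_of_mem _ ht)]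
  refine sum_mem fun p _ => ?_
  have := XL_mem_P (p + (((0 : ℕ) : ℤ), 0)) (key p)
  rw [map_sum] at this
  convert this using 1
  refine Finset.sum_congr rfl fun t ht => ?_
  rw [(Finset.mem_filter.1 ht).2]

theorem sig_add {q : ℂ} (hq : q ≠ 0) (n s r : ℤ × ℤ) (k : ℕ) :
    sig q (n + ((k : ℤ), 0)) s r = sig q n s r * (q ^ s.2) ^ k := by
  rw [sig, sig, ← zpow_natCast, ← zpow_mul, ← zpow_add₀ hq]
  congr 1; simp; ring

theorem E2_sig_mem_Gen {q : ℂ} (hq : q ≠ 0) (n : ℤ × ℤ) (g : NN m) :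
    (fun k : ℕ => E2 (sig q (n + ((k : ℤ), 0))) (n + ((k : ℤ), 0)) g) ∈ Gen m := by
  have : (fun k : ℕ => E2 (sig q (n + ((k : ℤ), 0))) (n + ((k : ℤ), 0)) g) =
      ∑ s ∈ nvars m g, ∑ r ∈ nvars m g, fun k : ℕ => sig q (n + ((k : ℤ), 0)) s r •
        XL (n + ((k : ℤ), 0) + s + r) (DL s (DL r g)) := by
    funext k
    simp only [E2_eq (supp_nvars g), Finset.sum_apply]
  rw [this]
  refine sum_mem fun s _ => sum_mem fun r _ => mem_Gen (sig q n s r) (zpow_ne_zero s.2 hq)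
    (n + s + r) (DL s (DL r g)) fun k => ?_
  rw [sig_add hq]
  congr 2; abel_nf

theorem E1_mem_Gen {c : ℕ → ℤ × ℤ → ℂ} (a z : ℤ × ℤ → ℂ) (hz : ∀ s, z s ≠ 0)
    (hc : ∀ k s, c k s = a s * z s ^ k) (n : ℤ × ℤ) (g : NN m) :
    (fun k : ℕ => E1 (c k) (n + ((k : ℤ), 0)) g) ∈ Gen m := by
  have : (fun k : ℕ => E1 (c k) (n + ((k : ℤ), 0)) g) =
      ∑ s ∈ nvars m g, fun k : ℕ => c k s • XL (n + ((k : ℤ), 0) + s) (DL s g) := by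
    funext k
    simp only [E1_eq (supp_nvars g), Finset.sum_apply]
  rw [this]
  refine sum_mem fun s _ => mem_Gen (a s) (hz s) (n + s) (DL s g) fun k => ?_
  rw [hc, add_right_comm]

theorem H_mem_Gen {q : ℂ} (hq : q ≠ 0) (n : ℤ × ℤ) (g : NN m) :
    (fun k : ℕ => H m q (n + ((k : ℤ), 0)) g) ∈ Gen m := by
  have : (fun k : ℕ => H m q (n + ((k : ℤ), 0)) g) =
      (fun k : ℕ => E1 (fun s => q ^ (m.2 * (n + ((k : ℤ), 0)).1) *
        q ^ (s.1 * (n + ((k : ℤ), 0) + m).2)) (n + m + ((k : ℤ), 0)) g) +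
      fun k : ℕ => E1 (fun s => q ^ ((n + ((k : ℤ), 0)).2 * m.1) *
        q ^ (s.2 * (n + ((k : ℤ), 0) + m).1)) (n + m + ((k : ℤ), 0)) g := by
    funext k
    rw [Pi.add_apply, E1_smul, E1_smul, H_apply, E22, E11, add_right_comm n m]
  rw [this]
  refine add_mem
    (E1_mem_Gen (fun s => q ^ (m.2 * n.1) * q ^ (s.1 * (n + m).2)) (fun _ => q ^ m.2)
      (fun _ => zpow_ne_zero _ hq) (fun k s => ?_) _ _)
    (E1_mem_Gen (fun s => q ^ (n.2 * m.1) * q ^ (s.2 * (n + m).1)) (fun s => q ^ s.2)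
      (fun _ => zpow_ne_zero _ hq) (fun k s => ?_) _ _) <;>
  · simp only [← zpow_natCast, ← zpow_mul, ← zpow_add₀ hq]
    congr 1; simp; ring

theorem XL_sig_mem_Gen {q : ℂ} (hq : q ≠ 0) (n : ℤ × ℤ) (g : NN m) :
    (fun k : ℕ => sig q (n + ((k : ℤ), 0)) m m • XL (n + ((k : ℤ), 0) + m + m) g) ∈ Gen m := by
  refine mem_Gen (sig q n m m) (zpow_ne_zero m.2 hq) (n + m + m) g fun k => ?_
  rw [sig_add hq]
  congr 2; abel_nf

/-- If every `Z(n)` maps `g` into `P`, then so does every `∂_s` with `s ≠ m`. -/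
theorem DL_mem_P_of_Z_mem_P {q μ κ : ℂ} (hq : q ≠ 0) (hμ : μ ≠ 0) (hκ : κ * (κ + 1) ≠ 0)
    {g : NN m} (h : ∀ n ≠ -m, Z m q μ κ n g ∈ PinN m) {s : ℤ × ℤ} (hs : s ≠ m) :
    DL s g ∈ PinN m := by
  let B : ℤ × ℤ → NN m := fun n => -(κ * (κ + 1)) • E2 (sig q n) n g
    + (κ + 1) • H m q n (F m q μ g) - sig q n m m • XL (n + m + m) (F m q μ (F m q μ g))
  have hZ : ∀ n, Z m q μ κ n g = (κ * (κ + 1) * (q ^ (-(n.1 * n.2)) * μ)) • DL (-n) g + B n := by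
    intro n
    simp only [B, Z_apply, E12_apply]
    module
  have hB : (fun k : ℕ => B (-s + ((k : ℤ), 0))) ∈ Gen m :=
    sub_mem (add_mem (Submodule.smul_mem _ _ (E2_sig_mem_Gen hq _ _))
      (Submodule.smul_mem _ _ (H_mem_Gen hq _ _))) (XL_sig_mem_Gen hq _ _)
  have hinj : Function.Injective fun k : ℕ => -s + ((k : ℤ), (0 : ℤ)) := fun a b h => by
    simpa using h
  have hne := hinj.tendsto_cofinite.eventually
    (((nvars m g).image (- ·) ∪ {-m}).finite_toSet.compl_mem_cofinite)
  rw [Nat.cofinite_eq_atTop] at hne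
  have h0 := Gen_zero_mem hB <| hne.mono fun k hk => by
    simp only [Finset.mem_coe, Finset.mem_union, Finset.mem_image,
      Finset.mem_singleton, not_or, not_exists, not_and] at hk
    have := h _ hk.2
    rwa [hZ, supp_nvars g _ (fun h' => hk.1 _ h' (neg_neg _)), smul_zero, zero_add] at this
  have h1 := h (-s) (fun h' => hs (neg_injective h'))
  have e : -s + (((0 : ℕ) : ℤ), (0 : ℤ)) = -s := by ext <;> simp
  simp only [e] at h0
  rw [hZ, neg_neg] at h1
  exact (Submodule.smul_mem_iff _ (mul_ne_zero hκ (mul_ne_zero (zpow_ne_zero _ hq) hμ))).1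
    ((Submodule.add_mem_iff_left _ h0).1 h1)

/-- Invariance under the operators `E_{ij}(n)`. -/
structure Inv (q μ : ℂ) (W : Submodule ℂ (NN m)) : Prop where
  XL_mem : ∀ n g, g ∈ W → XL n g ∈ W
  E12_mem : ∀ n g, g ∈ W → E12 q μ n g ∈ W
  E22_mem : ∀ n g, g ∈ W → E22 q n g ∈ W
  E11_mem : ∀ n g, g ∈ W → E11 q n g ∈ W

namespace Inv

variable {q μ : ℂ} {W : Submodule ℂ (NN m)}

theorem Eul_mem (hW : Inv q μ W) {g : NN m} (hg : g ∈ W) : Eul g ∈ W := by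
  rw [← E22_zero q]; exact hW.E22_mem _ _ hg

theorem F_mem (hW : Inv q μ W) {g : NN m} (hg : g ∈ W) : F m q μ g ∈ W :=
  W.smul_mem _ (hW.E12_mem _ _ hg)

theorem H_mem (hW : Inv q μ W) (n : ℤ × ℤ) {g : NN m} (hg : g ∈ W) : H m q n g ∈ W := by
  rw [H_apply]
  exact add_mem (W.smul_mem _ (hW.E22_mem _ _ hg)) (W.smul_mem _ (hW.E11_mem _ _ hg))

theorem Z_mem (hW : Inv q μ W) (κ : ℂ) (n : ℤ × ℤ) {g : NN m} (hg : g ∈ W) :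
    Z m q μ κ n g ∈ W := by
  rw [Z_apply]
  exact sub_mem (add_mem (W.smul_mem _ (hW.E12_mem _ _ hg))
    (W.smul_mem _ (hW.H_mem _ (hW.F_mem hg))))
    (W.smul_mem _ (hW.XL_mem _ _ (hW.F_mem (hW.F_mem hg))))

end Inv

theorem eq_zero_of_XL_mem_P {g : NN m} (h : XL m g ∈ PinN m) {k : ℤ} (hk : k < -1) : g k = 0 := by
  have := h (k + 1) (by omega)
  rwa [XL_apply, dif_pos rfl, add_sub_cancel_right] at this

theorem mem_P_of_XL_mem_P {g : NN m} (h : XL m g ∈ PinN m) (h1 : g (-1) = 0) : g ∈ PinN m := by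
  intro k hk
  rcases eq_or_ne k (-1) with rfl | hk'
  · exact h1
  · exact eq_zero_of_XL_mem_P h (by omega)

theorem eigenvalue_eq {g : NN m} {ε : ℂ} (hg : Eul g = ε • g) {k : ℤ} {σ : NVar m →₀ ℕ}
    (h : coeff σ (g k) ≠ 0) : ε = k + σ.degree := by
  have := coeff_Eul g k σ
  rw [hg, Finsupp.smul_apply, coeff_smul, smul_eq_mul] at this
  exact mul_right_cancel₀ h this

theorem single_sub_mem_P {g : NN m} (h : XL m g ∈ PinN m) :
    Finsupp.single (-1) (g (-1)) - g ∈ PinN m := by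
  refine mem_P_of_XL_mem_P ?_ (by simp)
  rw [map_sub, XL_single_self]
  refine sub_mem (fun k hk => ?_) h
  rw [Finsupp.single_eq_of_ne (by omega)]

theorem single_one_mem_of_eigenvector {q μ : ℂ} (hq : q ≠ 0) (hμ : ∀ z : ℤ, μ ≠ z)
    {W : Submodule ℂ (NN m)} (hPW : PinN m ≤ W) (hW : Inv q μ W) (d : ℕ) {g : NN m}
    (hgW : g ∈ W) (hgP : g ∉ PinN m) (hX : XL m g ∈ PinN m) (hE : Eul g = ((d : ℂ) - 1) • g) :
    (Finsupp.single (-1) 1 : NN m) ∈ W := by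
  have hκ : (μ - 2 * ((d : ℂ) - 1)) * (μ - 2 * ((d : ℂ) - 1) + 1) ≠ 0 := by
    refine mul_ne_zero (fun h => hμ (2 * (d - 1)) ?_) (fun h => hμ (2 * (d - 1) - 1) ?_) <;>
    · push_cast; linear_combination h
  have hμ0 : μ ≠ 0 := by simpa using hμ 0
  have hg1 : g (-1) ≠ 0 := fun h => hgP (mem_P_of_XL_mem_P hX h)
  induction d generalizing g with
  | zero =>
    have hC : g (-1) = C (coeff 0 (g (-1))) := by
      ext σ
      rw [coeff_C]
      split_ifs with h
      · rw [h]
      · by_contra h'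
        have := eigenvalue_eq hE h'
        simp only [Nat.cast_zero, zero_sub, Int.cast_neg, Int.cast_one, left_eq_add,
          Nat.cast_eq_zero, Finsupp.degree_eq_zero_iff] at this
        exact h this.symm
    have hc : coeff 0 (g (-1)) ≠ 0 := fun h => hg1 (by rw [hC, h, C_0])
    have := add_mem (hPW (single_sub_mem_P hX)) hgW
    rw [sub_add_cancel, hC, ← mul_one (coeff 0 (g (-1))), C_mul, C_1, ← smul_eq_C_mul,
      ← Finsupp.smul_single] at this
    exact (W.smul_mem_iff hc).1 this
  | succ d ih =>
    by_cases h : ∀ n ≠ -m, Z m q μ (μ - 2 * (((d + 1 : ℕ) : ℂ) - 1)) n g ∈ PinN m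
    · exfalso
      obtain ⟨S, hm, hS⟩ := exists_supp g {m}
      have h1 : Eul g - XL m (DL m g) ∈ PinN m := by
        rw [Eul, E1_eq hS, ← Finset.add_sum_erase _ _ (hm (Finset.mem_singleton_self m)), zero_add,
          one_smul, add_sub_cancel_left]
        exact sum_mem fun s hs => Submodule.smul_mem _ _ (XL_mem_P _
          (DL_mem_P_of_Z_mem_P hq hμ0 hκ h (Finset.mem_erase.1 hs).1))
      have h2 := h1 (-1) (by norm_num)
      rw [hE, Finsupp.sub_apply, Finsupp.smul_apply, XL_apply, dif_pos rfl, DL_apply, dif_pos rfl,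
        sub_add_cancel, ← sub_smul, smul_eq_zero] at h2
      refine h2.elim (fun h2 => ?_) hg1
      have : ((d + 1 : ℕ) : ℂ) = 0 := by push_cast at h2 ⊢; linear_combination h2
      exact Nat.cast_ne_zero.2 d.succ_ne_zero this
    · push Not at h
      obtain ⟨n, hn, hZ⟩ := h
      have hXZ : XL m (Z m q μ (μ - 2 * (((d + 1 : ℕ) : ℂ) - 1)) n g) ∈ PinN m := by
        rw [XL_Z hq μ _ hn hE]; exact Z_mem_P _ _ _ _ hX
      refine ih (hW.Z_mem _ n hgW) hZ hXZ ?_ ?_ (fun h => hZ (mem_P_of_XL_mem_P hXZ h))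
      · rw [Eul_Z _ _ _ _ _ hE]; push_cast; ring_nf
      · refine mul_ne_zero (fun h => hμ (2 * (d - 1)) ?_) (fun h => hμ (2 * (d - 1) - 1) ?_) <;>
        · push_cast; linear_combination h

theorem exists_eigenvector {q μ : ℂ} {W : Submodule ℂ (NN m)} (hPW : PinN m ≤ W)
    (hW : Inv q μ W) (hne : W ≠ PinN m) :
    ∃ (d : ℕ), ∃ g ∈ W, g ∉ PinN m ∧ XL m g ∈ PinN m ∧ Eul g = ((d : ℂ) - 1) • g := by
  classical
  obtain ⟨w, hw, hwP, hX⟩ : ∃ w ∈ W, w ∉ PinN m ∧ XL m w ∈ PinN m := by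
    obtain ⟨w, hw, hwP⟩ := SetLike.exists_of_lt (hPW.lt_of_ne' hne)
    by_contra! hcon
    have h1 : ∀ i : ℕ, (XL m)^[i] w ∈ W ∧ (XL m)^[i] w ∉ PinN m := by
      intro i
      induction i with
      | zero => exact ⟨hw, hwP⟩
      | succ i ih =>
        rw [Function.iterate_succ_apply']
        exact ⟨hW.XL_mem _ _ ih.1, hcon _ ih.1 ih.2⟩
    have h2 : ∀ (i : ℕ) (k : ℤ), (XL m)^[i] w k = w (k - i) := by
      intro i
      induction i with
      | zero => simp
      | succ i ih =>
        intro k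
        rw [Function.iterate_succ_apply', XL_apply, dif_pos rfl, ih]
        push_cast
        rw [sub_sub, add_comm]
    obtain ⟨N, hN⟩ := w.support.bddBelow
    refine (h1 N.natAbs).2 fun k hk => ?_
    rw [h2]
    by_contra h
    have := hN (Finsupp.mem_support_iff.2 h)
    omega
  have hex : ∃ c : ℕ, ∃ y : MvPolynomial (NVar m) ℂ, y ≠ 0 ∧ Finsupp.single (-1) y ∈ W ∧
      y.support.card = c :=
    ⟨_, w (-1), fun h => hwP (mem_P_of_XL_mem_P hX h), by
      simpa using add_mem (hPW (single_sub_mem_P hX)) hw, rfl⟩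
  obtain ⟨y, hy, hyW, hyc⟩ := Nat.find_spec hex
  obtain ⟨σ, hσ⟩ := MvPolynomial.exists_coeff_ne_zero hy
  set g : NN m := Finsupp.single (-1) y with hg
  have hXg : XL m g ∈ PinN m := by
    rw [hg, XL_single_self]
    intro k hk
    rw [Finsupp.single_eq_of_ne (by omega)]
  refine ⟨σ.degree, g, hyW, fun h => hy ?_, hXg, ?_⟩
  · simpa [hg] using h (-1) (by norm_num)
  · set y' : MvPolynomial (NVar m) ℂ := (Eul g - ((σ.degree : ℂ) - 1) • g) (-1) with hy'
    have hco : ∀ τ, coeff τ y' = ((τ.degree : ℂ) - σ.degree) * coeff τ y := by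
      intro τ
      rw [hy', Finsupp.sub_apply, coeff_sub, coeff_Eul, Finsupp.smul_apply, coeff_smul, hg,
        Finsupp.single_eq_same, smul_eq_mul]
      push_cast; ring
    have hs : Eul g - ((σ.degree : ℂ) - 1) • g = Finsupp.single (-1) y' := by
      ext k τ
      rcases eq_or_ne k (-1) with rfl | hk
      · simp [hy']
      · simp [coeff_Eul, hg, Finsupp.single_eq_of_ne hk]
    have hyW' : Finsupp.single (-1) y' ∈ W := by
      rw [← hs]
      exact sub_mem (hW.Eul_mem hyW) (W.smul_mem _ hyW)
    by_contra hne0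
    refine Nat.find_min hex (m := y'.support.card) ?_ ⟨y', fun h => hne0 ?_, hyW', rfl⟩
    · rw [← hyc]
      refine Finset.card_lt_card (Finset.ssubset_iff_of_subset ?_ |>.2 ⟨σ, ?_, ?_⟩)
      · intro τ hτ
        rw [MvPolynomial.mem_support_iff, hco] at hτ
        exact MvPolynomial.mem_support_iff.2 (right_ne_zero_of_mul hτ)
      · exact MvPolynomial.mem_support_iff.2 hσ
      · rw [MvPolynomial.notMem_support_iff, hco, sub_self, zero_mul]
    · rw [← sub_eq_zero, hs, h, Finsupp.single_zero]

theorem F_single_one {q : ℂ} (hq : q ≠ 0) (μ : ℂ) (j : ℤ) :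
    F m q μ (Finsupp.single j 1) = ((j : ℂ) * (μ - j + 1)) • Finsupp.single (j - 1) 1 := by
  have hS : Supp {m} (Finsupp.single j 1 : NN m) := by simpa using supp_single_C (m := m) j 1
  have h1 : sig q (-m) m m = q ^ (-(m.1 * m.2)) := by
    rw [sig]; congr 1; simp; ring
  have h2 : q ^ (m.1 * m.2) * q ^ (-(m.1 * m.2)) = 1 := by
    rw [← zpow_add₀ hq, add_neg_cancel, zpow_zero]
  rw [F_apply, E12_apply, E2_eq hS, Finset.sum_singleton, Finset.sum_singleton, h1,
    neg_add_cancel, zero_add, neg_neg, DL_single_self, DL_single_self, XL_single_self,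
    sub_add_cancel]
  simp only [Prod.fst_neg, Prod.snd_neg, neg_mul_neg, smul_smul, ← mul_assoc,
    ← Finsupp.smul_single, ← sub_smul]
  congr 1
  push_cast
  linear_combination (j * (μ - j + 1) : ℂ) * h2

theorem single_mem_of_single_one_mem {q μ : ℂ} {W : Submodule ℂ (NN m)} (hW : Inv q μ W) {j : ℤ}
    (h : (Finsupp.single j 1 : NN m) ∈ W) (y : MvPolynomial (NVar m) ℂ) :
    (Finsupp.single j y : NN m) ∈ W := by
  induction y using MvPolynomial.induction_on with
  | C a =>
    have := W.smul_mem a h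
    rwa [Finsupp.smul_single, smul_eq_C_mul, mul_one] at this
  | add p p' hp hp' => rw [Finsupp.single_add]; exact add_mem hp hp'
  | mul_X p i hp =>
    rw [mul_comm, ← XL_single i.1 i.2]
    exact hW.XL_mem _ _ hp

theorem eq_top_of_single_one_mem {q μ : ℂ} (hq : q ≠ 0) (hμ : ∀ z : ℤ, μ ≠ z)
    {W : Submodule ℂ (NN m)} (hPW : PinN m ≤ W) (hW : Inv q μ W)
    (h : (Finsupp.single (-1) 1 : NN m) ∈ W) : W = ⊤ := by
  have key : ∀ k : ℕ, (Finsupp.single (-1 - (k : ℤ)) 1 : NN m) ∈ W := by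
    intro k
    induction k with
    | zero => simpa using h
    | succ k ih =>
      have h1 := hW.F_mem ih
      rw [F_single_one hq] at h1
      have hne : ((-1 - (k : ℤ) : ℤ) : ℂ) * (μ - ((-1 - (k : ℤ) : ℤ) : ℂ) + 1) ≠ 0 := by
        refine mul_ne_zero (Int.cast_ne_zero.2 (by omega)) fun h0 => hμ (-2 - k) ?_
        push_cast at h0 ⊢
        linear_combination h0
      have := (W.smul_mem_iff hne).1 h1
      push_cast
      rwa [← sub_sub]
  refine eq_top_iff.2 fun g _ => ?_
  induction g using Finsupp.induction_linear with
  | zero => exact zero_mem _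
  | add f g hf hg => exact add_mem (hf trivial) (hg trivial)
  | single j y =>
    rcases lt_or_ge j 0 with hj | hj
    · obtain ⟨k, rfl⟩ : ∃ k : ℕ, j = -1 - (k : ℤ) := ⟨(-1 - j).toNat, by omega⟩
      exact single_mem_of_single_one_mem hW (key k) y
    · exact hPW fun k hk => Finsupp.single_eq_of_ne (by omega)

theorem F_pow_mem_P (q μ : ℂ) (k : ℕ) {g : NN m} (hg : g ∈ PinN m) :
    (F m q μ ^ k) g ∈ PinN m := by
  induction k generalizing g with
  | zero => exact hg
  | succ k ih => rw [pow_succ, Module.End.mul_apply]; exact ih (F_mem_P _ _ hg)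

/-- The elements of `N` on which `E12(-m)` acts nilpotently modulo `P`. -/
noncomputable def Nil (m : ℤ × ℤ) (q μ : ℂ) : Submodule ℂ (NN m) where
  carrier := {g | ∃ k : ℕ, (F m q μ ^ k) g ∈ PinN m}
  zero_mem' := ⟨0, by simp⟩
  add_mem' := by
    rintro a b ⟨k, hk⟩ ⟨l, hl⟩
    refine ⟨k + l, ?_⟩
    rw [map_add]
    refine add_mem ?_ ?_
    · rw [add_comm, pow_add, Module.End.mul_apply]; exact F_pow_mem_P _ _ _ hk
    · rw [pow_add, Module.End.mul_apply]; exact F_pow_mem_P _ _ _ hl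
  smul_mem' := by
    rintro c a ⟨k, hk⟩
    exact ⟨k, by rw [map_smul]; exact Submodule.smul_mem _ _ hk⟩

theorem P_le_Nil (q μ : ℂ) : PinN m ≤ Nil m q μ := fun _ hg => ⟨0, hg⟩

theorem mem_Nil_of_F_mem {q μ : ℂ} {g : NN m} (h : F m q μ g ∈ Nil m q μ) : g ∈ Nil m q μ := by
  obtain ⟨k, hk⟩ := h
  exact ⟨k + 1, by rwa [pow_succ, Module.End.mul_apply]⟩

/-- An operator preserving `P` preserves `Nil` if its commutator with `E12(-m)` does. -/
theorem Nil_invariant {q μ : ℂ} {A B : NN m → NN m} (hA : ∀ g ∈ PinN m, A g ∈ PinN m)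
    (hB : ∀ g ∈ Nil m q μ, B g ∈ Nil m q μ) (hAB : ∀ g, F m q μ (A g) = A (F m q μ g) + B g)
    {g : NN m} (hg : g ∈ Nil m q μ) : A g ∈ Nil m q μ := by
  obtain ⟨k, hk⟩ := hg
  induction k generalizing g with
  | zero => exact P_le_Nil q μ (hA g hk)
  | succ k ih =>
    refine mem_Nil_of_F_mem ?_
    rw [hAB]
    refine add_mem (ih ?_) (hB g ⟨k + 1, hk⟩)
    rwa [pow_succ, Module.End.mul_apply] at hk

theorem Nil_inv {q : ℂ} (hq : q ≠ 0) (μ : ℂ) : Inv q μ (Nil m q μ) := by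
  have h12 : ∀ n g, g ∈ Nil m q μ → E12 q μ n g ∈ Nil m q μ := fun n g =>
    Nil_invariant (fun g => E12_mem_P q μ n) (fun _ _ => zero_mem _) fun g => by
      rw [F_apply, F_apply, E12_comm hq, map_smul, add_zero]
  have h22 : ∀ n g, g ∈ Nil m q μ → E22 q n g ∈ Nil m q μ := fun n g =>
    Nil_invariant (A := E22 q n) (fun g => E1_mem_P _ n)
      (fun g hg => Submodule.smul_mem _ _ (Submodule.smul_mem _ _ (h12 _ g hg))) fun g => by
        rw [F_apply, F_apply, E12_E22 hq, smul_add, map_smul]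
  have h11 : ∀ n g, g ∈ Nil m q μ → E11 q n g ∈ Nil m q μ := fun n g =>
    Nil_invariant (A := E11 q n) (fun g => E1_mem_P _ n)
      (fun g hg => Submodule.smul_mem _ _ (Submodule.smul_mem _ _ (h12 _ g hg))) fun g => by
        rw [F_apply, F_apply, E12_E11 hq, smul_add, map_smul]
  refine ⟨fun n g => Nil_invariant (A := XL n) (fun g => XL_mem_P n)
    (B := fun g => F m q μ (XL n g) - XL n (F m q μ g)) (fun g hg => ?_)
    (fun g => by rw [add_sub_cancel]), h12, h22, h11⟩
  rw [F_apply, F_apply, E12_XL hq, map_smul, ← smul_sub]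
  refine Submodule.smul_mem _ _ ?_
  rw [show ∀ a b c d : NN m, a + b - c - d - a = b - (c + d) from fun _ _ _ _ => by abel]
  refine sub_mem ?_ (add_mem (Submodule.smul_mem _ _ (h22 _ _ hg))
    (Submodule.smul_mem _ _ (h11 _ _ hg)))
  split_ifs
  · exact Submodule.smul_mem _ _ hg
  · exact zero_mem _

theorem E1_zero_mem_Nil (q μ : ℂ) {w : ℤ × ℤ → ℂ}
    (hw : ∀ s r, w s + w r - w (-m + s + r) = w m) {g : NN m} (hg : g ∈ Nil m q μ) :
    E1 w 0 g ∈ Nil m q μ := by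
  refine Nil_invariant (A := E1 w 0) (B := fun g => w m • F m q μ g) (fun g => E1_mem_P _ _)
    (fun g hg => ?_) (fun g => ?_) hg
  · obtain ⟨k, hk⟩ := hg
    refine Submodule.smul_mem _ _ ⟨k, ?_⟩
    rw [← Module.End.mul_apply, ← pow_succ, pow_succ', Module.End.mul_apply]
    exact F_mem_P _ _ hk
  · rw [F_apply, E12_weight q μ (-m) w (w m) hw (by rw [neg_neg]), F_apply, map_smul, smul_add,
      smul_comm (w m)]

theorem exists_mem_Nil_notMem_P {q : ℂ} (hq : q ≠ 0) (z : ℤ) :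
    ∃ g ∈ Nil m q z, g ∉ PinN m := by
  obtain ⟨r, hr⟩ : ∃ r, r ≠ m := exists_ne m
  obtain ⟨d, hd⟩ : ∃ d : ℕ, z + 2 ≤ d := ⟨(z + 2).toNat, by omega⟩
  obtain ⟨i, hi⟩ : ∃ i : ℕ, (i : ℤ) = 2 * (d - 1) - z := ⟨(2 * (d - 1) - z).toNat, by omega⟩
  set w : ℕ → NN m := fun d => Finsupp.single (-1) (X ⟨r, hr⟩ ^ d) with hw
  have hwP : w d ∉ PinN m := fun h => by
    have := h (-1) (by norm_num)
    rw [hw, Finsupp.single_eq_same] at this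
    exact pow_ne_zero _ (X_ne_zero _) this
  have hXw : XL m (w d) ∈ PinN m := by
    rw [hw, XL_single_self]
    exact fun k hk => Finsupp.single_eq_of_ne (by omega)
  have hEw : ∀ d : ℕ, Eul (w d) = ((d : ℂ) - 1) • w d := by
    intro d
    induction d with
    | zero => simpa [hw] using Eul_single_C (m := m) (-1) 1
    | succ d ih =>
      have : w (d + 1) = XL r (w d) := by simp only [hw, XL_single r hr, pow_succ']
      rw [this, Eul_XL, ih, map_smul]
      push_cast
      module
  have hEF : ∀ i : ℕ, Eul ((F m q (z : ℂ) ^ i) (w d)) =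
      ((d : ℂ) - 1 - i) • (F m q (z : ℂ) ^ i) (w d) := by
    intro i
    induction i with
    | zero => simpa using hEw d
    | succ i ih =>
      rw [pow_succ', Module.End.mul_apply, Eul_F, ih, map_smul]
      push_cast
      module
  have hXF : ∀ i : ℕ, XL m ((F m q (z : ℂ) ^ (i + 1)) (w d)) +
      (((i : ℂ) + 1) * (z - 2 * (d - 1) + i)) • (F m q (z : ℂ) ^ i) (w d) ∈ PinN m := by
    intro i
    induction i with
    | zero =>
      convert F_mem_P q (z : ℂ) hXw using 1
      simp only [zero_add, pow_one, pow_zero, Module.End.one_apply, XL_F hq, hEw]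
      push_cast
      module
    | succ i ih =>
      convert F_mem_P q (z : ℂ) ih using 1
      rw [pow_succ', Module.End.mul_apply, XL_F hq, hEF, map_add, map_smul,
        ← Module.End.mul_apply (F m q (z : ℂ)) (F m q (z : ℂ) ^ i), ← pow_succ']
      push_cast
      module
  have hX : XL m ((F m q (z : ℂ) ^ (i + 1)) (w d)) ∈ PinN m := by
    have h0 : (z : ℂ) - 2 * (d - 1) + i = 0 := by
      have : (i : ℂ) = 2 * (d - 1) - z := by exact_mod_cast hi
      rw [this]; ring
    simpa [h0] using hXF i
  refine ⟨w d, ⟨i + 1, mem_P_of_XL_mem_P hX ?_⟩, hwP⟩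
  by_contra h
  obtain ⟨σ, hσ⟩ := MvPolynomial.exists_coeff_ne_zero h
  have h1 := eigenvalue_eq (hEF (i + 1)) hσ
  have h2 : (d : ℤ) - 1 - (i + 1) = -1 + σ.degree := by exact_mod_cast h1
  omega

theorem Nil_ne_top {q : ℂ} (hq : q ≠ 0) (z : ℤ) : Nil m q z ≠ ⊤ := by
  intro htop
  obtain ⟨K, hK⟩ : ∃ K : ℕ, 0 < z + K + 1 ∧ 0 < K := ⟨(-z).toNat + 1, by omega, by omega⟩
  have key : ∀ i : ℕ, ∃ c : ℂ, c ≠ 0 ∧ (F m q (z : ℂ) ^ i) (Finsupp.single (-(K : ℤ)) 1) =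
      c • Finsupp.single (-(K : ℤ) - i) 1 := by
    intro i
    induction i with
    | zero => exact ⟨1, one_ne_zero, by simp⟩
    | succ i ih =>
      obtain ⟨c, hc, h⟩ := ih
      refine ⟨c * (((-(K : ℤ) - i : ℤ) : ℂ) * (z - ((-(K : ℤ) - i : ℤ) : ℂ) + 1)),
        mul_ne_zero hc (mul_ne_zero (Int.cast_ne_zero.2 (by omega)) ?_), ?_⟩
      · exact_mod_cast (show z - (-(K : ℤ) - i) + 1 ≠ 0 by omega)
      · rw [pow_succ', Module.End.mul_apply, h, map_smul, F_single_one hq, smul_smul]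
        push_cast
        rw [sub_sub]
  obtain ⟨i, hi⟩ : (Finsupp.single (-(K : ℤ)) 1 : NN m) ∈ Nil m q z := htop ▸ trivial
  obtain ⟨c, hc, h⟩ := key i
  have := hi (-(K : ℤ) - i) (by omega)
  rw [h, Finsupp.smul_apply, Finsupp.single_eq_same, smul_eq_zero] at this
  exact this.elim hc one_ne_zero

end LocQuot

/-- the only subspaces of `Q = N/P` invariant under all induced operators
are `{0}` and `Q` iff `μ ∉ ℤ`. (Subspaces of `N/P` correspond to submodules `W` of `N`
with `P ≤ W`; invariance of `W/P` under the induced operators is invariance of `W`,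
`W/P = 0` iff `W = P`, and `W/P = Q` iff `W = ⊤`.) -/
theorem stmt13 (q μ : ℂ) (hq : q ≠ 0) (m : ℤ × ℤ) :
    (∀ W : Submodule ℂ (NN m), PinN m ≤ W →
      (∀ (n : ℤ × ℤ) (g : NN m), g ∈ W →
        E11N q μ m n g ∈ W ∧ E12N q μ m n g ∈ W ∧ E21N m n g ∈ W ∧ E22N q m n g ∈ W) →
      (∀ g ∈ W, D1N m g ∈ W ∧ D2N m g ∈ W) →
      W = PinN m ∨ W = ⊤) ↔ (∀ z : ℤ, μ ≠ (z : ℂ)) := by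
  constructor
  · rintro h z rfl
    have hN := LocQuot.Nil_inv (m := m) hq (z : ℂ)
    have h1 := h (LocQuot.Nil m q z) (LocQuot.P_le_Nil q z)
    rw [imp_iff_right, imp_iff_right] at h1
    · obtain ⟨g, hg, hg'⟩ := LocQuot.exists_mem_Nil_notMem_P (m := m) hq z
      exact h1.elim (fun h => hg' (h ▸ hg)) (LocQuot.Nil_ne_top hq z)
    · refine fun g hg => ⟨?_, ?_⟩
      · rw [LocQuot.D1N_eq]
        exact LocQuot.E1_zero_mem_Nil q z
          (fun s r => by push_cast [Prod.fst_add, Prod.fst_neg]; ring) hg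
      · rw [LocQuot.D2N_eq]
        exact LocQuot.E1_zero_mem_Nil q z
          (fun s r => by push_cast [Prod.snd_add, Prod.snd_neg]; ring) hg
    · refine fun n g hg => ⟨?_, ?_, hN.XL_mem n g hg, hN.E22_mem n g hg⟩
      · rw [LocQuot.E11N_eq]
        refine sub_mem ?_ (hN.E11_mem n g hg)
        split_ifs
        exacts [Submodule.smul_mem _ _ hg, zero_mem _]
      · rw [LocQuot.E12N_eq]
        exact hN.E12_mem n g hg
  · intro hμ W hPW hW _
    refine or_iff_not_imp_left.2 fun hne => ?_
    have hI : LocQuot.Inv q μ W :=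
      { XL_mem := fun n g hg => (hW n g hg).2.2.1
        E12_mem := fun n g hg => LocQuot.E12N_eq q μ n g ▸ (hW n g hg).2.1
        E22_mem := fun n g hg => (hW n g hg).2.2.2
        E11_mem := fun n g hg => by
          have h0 : (if n = 0 then μ • g else 0) ∈ W := by
            split_ifs
            exacts [W.smul_mem _ hg, zero_mem _]
          have h1 := sub_mem h0 (hW n g hg).1
          rwa [LocQuot.E11N_eq, sub_sub_cancel] at h1 }
    obtain ⟨d, g, hgW, hgP, hX, hE⟩ := LocQuot.exists_eigenvector hPW hI hne
    exact LocQuot.eq_top_of_single_one_mem hq hμ hPW hI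
      (LocQuot.single_one_mem_of_eigenvector hq hμ hPW hI d hgW hgP hX hE)
end

section
/- Assume μ ∈ ℤ. Then there exists a nonzero element w of the quotient Q = N/P such that the induced operator E12(−m) annihilates w, i.e. E12(−m)·w = 0 in Q. -/
open MvPolynomial Finsupp

/-- Euler's identity in an arbitrary set of variables, summing over any finite set of
variables that contains those occurring in the polynomial. -/
theorem sum_X_mul_pderiv_of_vars_subset {σ R : Type*} [CommSemiring R] {a : MvPolynomial σ R}
    {e : ℕ} (ha : a.IsHomogeneous e) {V : Finset σ} (hV : a.vars ⊆ V) :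
    ∑ r ∈ V, X r * pderiv r a = e • a := by
  classical
  have key : ∀ d ∈ a.support, ∑ r ∈ V, X r * pderiv r (monomial d (coeff d a))
      = e • monomial d (coeff d a) := by
    intro d hd
    simp_rw [X_mul_pderiv_monomial]
    rw [← Finset.sum_smul]
    congr 1
    have hdV : d.support ⊆ V := fun i hi => hV ((mem_vars_iff_mem_support i).2 ⟨d, hd, hi⟩)
    rw [ha.degree_eq_sum_deg_support hd]
    exact (Finset.sum_subset hdV fun i _ hi => by simpa using hi).symm
  conv_lhs => rw [a.as_sum]
  conv_rhs => rw [a.as_sum, Finset.smul_sum]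
  simp_rw [map_sum, Finset.mul_sum]
  rw [Finset.sum_comm]
  exact Finset.sum_congr rfl key

theorem Xop_apply (m k : ℤ × ℤ) (g : NN m) (j : ℤ) :
    Xop m k g j = if h : k = m then g (j - 1) else X (⟨k, h⟩ : NVar m) * g j := by
  unfold Xop
  split_ifs with h
  · have := Finsupp.mapDomain_apply (add_left_injective (1 : ℤ)) g (j - 1)
    simpa [XmZ] using this
  · simp

theorem Dop_self_apply (m : ℤ × ℤ) (g : NN m) (j : ℤ) :
    Dop m m g j = (j + 1) • g (j + 1) := by
  classical
  unfold Dop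
  rw [dif_pos rfl, Finsupp.sum_apply, Finsupp.sum, Finset.sum_eq_single (j + 1)]
  · simp
  · intro b _ hb
    rw [Finsupp.single_apply, if_neg (by omega)]
  · intro h
    simp [Finsupp.notMem_support_iff.1 h]

theorem Dop_coe_apply {m : ℤ × ℤ} (s : NVar m) (g : NN m) (j : ℤ) :
    Dop m s g j = pderiv s (g j) := by
  unfold Dop
  rw [dif_neg s.2]
  simp

/-- The variables other than `x_m` occurring in an element of `N`. -/
noncomputable def coeffVars {m : ℤ × ℤ} (g : NN m) : Finset (NVar m) :=
  g.support.biUnion fun k => (g k).vars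

theorem vars_subset_coeffVars {m : ℤ × ℤ} (g : NN m) (j : ℤ) : (g j).vars ⊆ coeffVars g := by
  by_cases h : g j = 0
  · simp [h]
  · exact Finset.subset_biUnion_of_mem (fun k => (g k).vars) (Finsupp.mem_support_iff.2 h)

theorem sum_nvars {M : Type*} [AddCommMonoid M] {m : ℤ × ℤ} (g : NN m) (f : ℤ × ℤ → M) :
    ∑ s ∈ nvars m g, f s = f m + ∑ s ∈ coeffVars g, f s := by
  classical
  have h : nvars m g = insert m ((coeffVars g).image Subtype.val) := by
    unfold nvars coeffVars
    rw [Finset.biUnion_image]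
  rw [h, Finset.sum_insert, Finset.sum_image Subtype.val_injective.injOn]
  simp only [Finset.mem_image, not_exists, not_and]
  exact fun s _ => s.2

/-- The coefficient of `x_{s+r-m} ∂_s ∂_r` in `-E12(-m)`. -/
noncomputable def quadCoeff (q : ℂ) (m s r : ℤ × ℤ) : ℂ :=
  q ^ ((-m).2 * r.1 + s.2 * (-m).1 + s.2 * r.1)

/-- The part of the quadratic operator in `-E12(-m)` whose terms do not involve `x_m`. -/
noncomputable def quadMul (q : ℂ) (m : ℤ × ℤ) (V : Finset (NVar m))
    (a : MvPolynomial (NVar m) ℂ) : MvPolynomial (NVar m) ℂ :=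
  ∑ s ∈ V, ∑ r ∈ V, quadCoeff q m s r •
    (if h : -m + s.1 + r.1 = m then 0
      else X (⟨-m + s.1 + r.1, h⟩ : NVar m) * pderiv s (pderiv r a))

/-- The coefficient of `x_m` in the terms of `-E12(-m)` without `∂_m`. -/
noncomputable def quadContract (q : ℂ) (m : ℤ × ℤ) (V : Finset (NVar m))
    (a : MvPolynomial (NVar m) ℂ) : MvPolynomial (NVar m) ℂ :=
  ∑ s ∈ V, ∑ r ∈ V, quadCoeff q m s r •
    (if -m + s.1 + r.1 = m then pderiv s (pderiv r a) else 0)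

theorem pderiv_pderiv_eq_zero {σ R : Type*} [CommSemiring R] {a : MvPolynomial σ R} {s r : σ}
    (h : s ∉ a.vars ∨ r ∉ a.vars) : pderiv s (pderiv r a) = 0 := by
  rcases h with h | h
  · rw [a.as_sum, map_sum, map_sum]
    refine Finset.sum_eq_zero fun d hd => ?_
    have hds : d s = 0 := by
      by_contra hne
      exact h ((mem_vars_iff_mem_support s).2 ⟨d, hd, Finsupp.mem_support_iff.2 hne⟩)
    simp [pderiv_monomial, hds]
  · rw [pderiv_eq_zero_of_notMem_vars h, map_zero]

theorem sum_sum_eq_of_subset {α M : Type*} [AddCommMonoid M] {U V : Finset α} (h : U ⊆ V)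
    {f : α → α → M} (hf : ∀ s r, s ∉ U ∨ r ∉ U → f s r = 0) :
    ∑ s ∈ V, ∑ r ∈ V, f s r = ∑ s ∈ U, ∑ r ∈ U, f s r := by
  rw [← Finset.sum_subset h fun s _ hs => Finset.sum_eq_zero fun r _ => hf s r (.inl hs)]
  exact Finset.sum_congr rfl fun s _ =>
    (Finset.sum_subset h fun r _ hr => hf s r (.inr hr)).symm

theorem quadMul_eq_of_subset (q : ℂ) {m : ℤ × ℤ} {V : Finset (NVar m)}
    {a : MvPolynomial (NVar m) ℂ} (h : a.vars ⊆ V) :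
    quadMul q m V a = quadMul q m a.vars a :=
  sum_sum_eq_of_subset h fun s r hsr => by simp [pderiv_pderiv_eq_zero hsr]

theorem quadContract_eq_of_subset (q : ℂ) {m : ℤ × ℤ} {V : Finset (NVar m)}
    {a : MvPolynomial (NVar m) ℂ} (h : a.vars ⊆ V) :
    quadContract q m V a = quadContract q m a.vars a :=
  sum_sum_eq_of_subset h fun s r hsr => by simp [pderiv_pderiv_eq_zero hsr]

theorem E12N_neg_apply (q μ : ℂ) (m : ℤ × ℤ) (w : NN m) (j : ℤ) (e : ℕ)
    (he : (w (j + 1)).IsHomogeneous e) :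
    E12N q μ m (-m) w j =
      (q ^ (-(m.1 * m.2)) * ((j + 1) * (μ - j - 2 * e))) • w (j + 1)
        - quadMul q m (w j).vars (w j) - quadContract q m (w (j - 1)).vars (w (j - 1)) := by
  have hE := sum_X_mul_pderiv_of_vars_subset he (vars_subset_coeffVars w (j + 1))
  have hmm : (q ^ ((-m).2 * m.1 + m.2 * (-m).1 + m.2 * m.1) •
      Xop m (-m + m + m) (Dop m m (Dop m m w))) j =
      (q ^ (-(m.1 * m.2)) * (j * (j + 1))) • w (j + 1) := by
    have h1 : -m + m + m = m := by abel
    have h2 : (-m).2 * m.1 + m.2 * (-m).1 + m.2 * m.1 = -(m.1 * m.2) := by simp; ring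
    rw [h2, Finsupp.smul_apply, Xop_apply, dif_pos h1, Dop_self_apply, Dop_self_apply]
    simp only [sub_add_cancel, mul_smul, ← Int.cast_smul_eq_zsmul ℂ]
    push_cast
    rfl
  have hms : ∀ r : NVar m, (q ^ ((-m).2 * r.1.1 + m.2 * (-m).1 + m.2 * r.1.1) •
      Xop m (-m + m + r.1) (Dop m m (Dop m r w))) j =
      (q ^ (-(m.1 * m.2)) * (j + 1)) • (X r * pderiv r (w (j + 1))) := by
    intro r
    have h1 : -m + m + r.1 = r.1 := by abel
    have h2 : (-m).2 * r.1.1 + m.2 * (-m).1 + m.2 * r.1.1 = -(m.1 * m.2) := by simp; ring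
    rw [h2, Finsupp.smul_apply, h1, Xop_apply, dif_neg r.2, Dop_self_apply, Dop_coe_apply]
    simp only [mul_smul, ← Int.cast_smul_eq_zsmul ℂ, mul_smul_comm]
    push_cast
    rfl
  have hsm : ∀ s : NVar m, (q ^ ((-m).2 * m.1 + s.1.2 * (-m).1 + s.1.2 * m.1) •
      Xop m (-m + s.1 + m) (Dop m s (Dop m m w))) j =
      (q ^ (-(m.1 * m.2)) * (j + 1)) • (X s * pderiv s (w (j + 1))) := by
    intro r
    have h1 : -m + r.1 + m = r.1 := by abel
    have h2 : (-m).2 * m.1 + r.1.2 * (-m).1 + r.1.2 * m.1 = -(m.1 * m.2) := by simp; ring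
    rw [h2, Finsupp.smul_apply, h1, Xop_apply, dif_neg r.2, Dop_coe_apply, Dop_self_apply]
    simp only [mul_smul, ← Int.cast_smul_eq_zsmul ℂ, Derivation.map_smul, mul_smul_comm]
    push_cast
    rfl
  have hsr : ∀ s r : NVar m, (q ^ ((-m).2 * r.1.1 + s.1.2 * (-m).1 + s.1.2 * r.1.1) •
      Xop m (-m + s.1 + r.1) (Dop m s (Dop m r w))) j =
      quadCoeff q m s r • (if h : -m + s.1 + r.1 = m then 0
        else X (⟨-m + s.1 + r.1, h⟩ : NVar m) * pderiv s (pderiv r (w j))) +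
      quadCoeff q m s r • (if -m + s.1 + r.1 = m then pderiv s (pderiv r (w (j - 1))) else 0) := by
    intro s r
    rw [Finsupp.smul_apply, Xop_apply]
    split_ifs <;> simp [Dop_coe_apply, quadCoeff]
  rw [← quadMul_eq_of_subset q (vars_subset_coeffVars w j),
    ← quadContract_eq_of_subset q (vars_subset_coeffVars w (j - 1))]
  unfold E12N
  simp only [sum_nvars, Finsupp.sub_apply, Finsupp.add_apply, Finsupp.finsetSum_apply, hmm, hms,
    hsm, hsr, Finset.sum_add_distrib, ← Finset.smul_sum, hE]
  have hd : (q ^ (-((-m).1 * (-m).2)) • μ • Dop m (- -m) w) j =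
      (q ^ (-(m.1 * m.2)) * (μ * (j + 1))) • w (j + 1) := by
    rw [neg_neg, Finsupp.smul_apply, Finsupp.smul_apply, Dop_self_apply]
    simp only [mul_smul, ← Int.cast_smul_eq_zsmul ℂ, Prod.fst_neg, Prod.snd_neg, neg_mul_neg]
    push_cast
    rfl
  rw [hd, ← Nat.cast_smul_eq_nsmul ℂ]
  change _ - (_ + _ + (_ + (quadMul q m _ _ + quadContract q m _ _))) = _
  module

theorem quadMul_isHomogeneous (q : ℂ) {m : ℤ × ℤ} (V : Finset (NVar m))
    {a : MvPolynomial (NVar m) ℂ} {e : ℕ} (ha : a.IsHomogeneous (e + 1)) :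
    (quadMul q m V a).IsHomogeneous e := by
  refine IsHomogeneous.sum _ _ _ fun s _ => IsHomogeneous.sum _ _ _ fun r _ => ?_
  rw [smul_eq_C_mul]
  refine IsHomogeneous.C_mul ?_ _
  split_ifs with h
  · exact isHomogeneous_zero _ _ _
  · have h1 : (pderiv r a).IsHomogeneous e := ha.pderiv
    obtain _ | e := e
    · rw [← totalDegree_zero_iff_isHomogeneous, totalDegree_eq_zero_iff_eq_C] at h1
      rw [h1, pderiv_C, mul_zero]
      exact isHomogeneous_zero _ _ _
    · simpa [add_comm] using (isHomogeneous_X ℂ (⟨_, h⟩ : NVar m)).mul (h1.pderiv (i := s))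

theorem quadContract_isHomogeneous (q : ℂ) {m : ℤ × ℤ} (V : Finset (NVar m))
    {a : MvPolynomial (NVar m) ℂ} {e : ℕ} (ha : a.IsHomogeneous (e + 2)) :
    (quadContract q m V a).IsHomogeneous e := by
  refine IsHomogeneous.sum _ _ _ fun s _ => IsHomogeneous.sum _ _ _ fun r _ => ?_
  rw [smul_eq_C_mul]
  refine IsHomogeneous.C_mul ?_ _
  split_ifs with h
  · exact ha.pderiv.pderiv
  · exact isHomogeneous_zero _ _ _

theorem pderiv_pderiv_eq_zero_of_isHomogeneous {σ R : Type*} [CommSemiring R]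
    {a : MvPolynomial σ R} {e : ℕ} (ha : a.IsHomogeneous e) (he : e ≤ 1) (s r : σ) :
    pderiv s (pderiv r a) = 0 := by
  have h1 := ha.pderiv (i := r)
  rw [show e - 1 = 0 by omega, ← totalDegree_zero_iff_isHomogeneous,
    totalDegree_eq_zero_iff_eq_C] at h1
  rw [h1, pderiv_C]

theorem quadMul_eq_zero (q : ℂ) {m : ℤ × ℤ} (V : Finset (NVar m))
    {a : MvPolynomial (NVar m) ℂ} {e : ℕ} (ha : a.IsHomogeneous e) (he : e ≤ 1) :
    quadMul q m V a = 0 := by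
  simp [quadMul, pderiv_pderiv_eq_zero_of_isHomogeneous ha he]

theorem quadContract_eq_zero (q : ℂ) {m : ℤ × ℤ} (V : Finset (NVar m))
    {a : MvPolynomial (NVar m) ℂ} {e : ℕ} (ha : a.IsHomogeneous e) (he : e ≤ 1) :
    quadContract q m V a = 0 := by
  simp [quadContract, pderiv_pderiv_eq_zero_of_isHomogeneous ha he]

/-- The coefficients of a singular vector of total degree `-1` for `μ = d - 2`, in increasing
order of the exponent of `x_m`: the `n`-th one has degree `d + 1 - n` and belongs to the
exponent `n - d - 2`. -/
noncomputable def singularCoeff (q : ℂ) (m : ℤ × ℤ) (t : NVar m) (d : ℕ) :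
    ℕ → MvPolynomial (NVar m) ℂ
  | 0 => 0
  | 1 => X t ^ d
  | n + 2 => (q ^ (-(m.1 * m.2)) * (((n : ℂ) - d) * (n + 1)))⁻¹ •
      (quadMul q m (singularCoeff q m t d (n + 1)).vars (singularCoeff q m t d (n + 1)) +
        quadContract q m (singularCoeff q m t d n).vars (singularCoeff q m t d n))

theorem singularCoeff_isHomogeneous (q : ℂ) (m : ℤ × ℤ) (t : NVar m) (d n e : ℕ)
    (h : n + e = d + 1) : (singularCoeff q m t d n).IsHomogeneous e := by
  induction n using Nat.twoStepInduction generalizing e with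
  | zero => exact isHomogeneous_zero _ _ _
  | one =>
    obtain rfl : e = d := by omega
    exact isHomogeneous_X_pow _ _
  | more n ih0 ih1 =>
    rw [singularCoeff, smul_eq_C_mul]
    exact ((quadMul_isHomogeneous q _ (ih1 (e + 1) (by omega))).add
      (quadContract_isHomogeneous q _ (ih0 (e + 2) (by omega)))).C_mul _

/-- The singular vector of total degree `-1` for `μ = d - 2`. -/
noncomputable def singularVector (q : ℂ) (m : ℤ × ℤ) (t : NVar m) (d : ℕ) : NN m :=
  Finsupp.onFinset (Finset.Icc (-(d : ℤ) - 1) (-1))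
    (fun j => if j < 0 then singularCoeff q m t d (j + d + 2).toNat else 0) fun j hj => by
      rw [Finset.mem_Icc]
      by_contra hc
      apply hj
      split_ifs with h
      · rw [show (j + d + 2).toNat = 0 by omega, singularCoeff]
      · rfl

theorem singularVector_apply (q : ℂ) (m : ℤ × ℤ) (t : NVar m) (d : ℕ) (j : ℤ) :
    singularVector q m t d j =
      if j < 0 then singularCoeff q m t d (j + d + 2).toNat else 0 :=
  rfl

theorem singularVector_apply_eq_zero (q : ℂ) (m : ℤ × ℤ) (t : NVar m) (d : ℕ) {j : ℤ}
    (hj : j + d + 2 ≤ 0) : singularVector q m t d j = 0 := by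
  rw [singularVector_apply, Int.toNat_of_nonpos hj, singularCoeff, ite_self]

theorem singularVector_notMem_PinN (q : ℂ) (m : ℤ × ℤ) (t : NVar m) (d : ℕ) :
    singularVector q m t d ∉ PinN m := by
  intro h
  have h1 := h (-(d : ℤ) - 1) (by omega)
  rw [singularVector_apply, if_pos (by omega),
    show (-(d : ℤ) - 1 + d + 2).toNat = 1 by omega, singularCoeff] at h1
  exact pow_ne_zero d (X_ne_zero t) h1

theorem E12N_singularVector_mem_PinN (q : ℂ) (hq : q ≠ 0) (m : ℤ × ℤ) (t : NVar m) (d : ℕ) :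
    E12N q ((d : ℂ) - 2) m (-m) (singularVector q m t d) ∈ PinN m := by
  intro j hj
  by_cases hlow : j + d + 2 ≤ 0
  · have h0 := singularVector_apply_eq_zero q m t d hlow
    have h1 := singularVector_apply_eq_zero q m t d (j := j - 1) (by omega)
    rcases hlow.lt_or_eq with hlt | heq
    · have h2 := singularVector_apply_eq_zero q m t d (j := j + 1) (by omega)
      rw [E12N_neg_apply q _ m _ j 0 (by rw [h2]; exact isHomogeneous_zero _ _ _), h0, h1, h2]
      simp [quadMul, quadContract]
    · have h2 : (singularVector q m t d (j + 1)).IsHomogeneous d := by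
        rw [singularVector_apply]
        split_ifs
        · exact singularCoeff_isHomogeneous q m t d _ _ (by omega)
        · exact isHomogeneous_zero _ _ _
      rw [E12N_neg_apply q _ m _ j d h2, h0, h1]
      have hjc : (j : ℂ) = -d - 2 := by
        have : j = -d - 2 := by omega
        rw [this]; push_cast; ring
      rw [show (d : ℂ) - 2 - j - 2 * d = 0 by rw [hjc]; ring]
      simp [quadMul, quadContract]
  · obtain ⟨n, hn⟩ : ∃ n : ℕ, j + d + 2 = n + 1 := ⟨(j + d + 1).toNat, by omega⟩
    have h0 : singularVector q m t d j = singularCoeff q m t d (n + 1) := by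
      rw [singularVector_apply, if_pos hj, show (j + d + 2).toNat = n + 1 by omega]
    have h1 : singularVector q m t d (j - 1) = singularCoeff q m t d n := by
      rw [singularVector_apply, if_pos (by omega), show (j - 1 + d + 2).toNat = n by omega]
    rcases (show j ≤ -1 by omega).lt_or_eq with hlt | heq
    · have h2 : singularVector q m t d (j + 1) = singularCoeff q m t d (n + 2) := by
        rw [singularVector_apply, if_pos (by omega),
          show (j + 1 + d + 2).toNat = n + 2 by omega]
      obtain ⟨e, he⟩ : ∃ e : ℕ, n + 2 + e = d + 1 := ⟨d - 1 - n, by omega⟩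
      rw [E12N_neg_apply q _ m _ j e
        (by rw [h2]; exact singularCoeff_isHomogeneous q m t d _ _ he), h0, h1, h2]
      have hec : (d : ℂ) = n + 1 + e := by
        have : d = n + 1 + e := by omega
        rw [this]; push_cast; ring
      have hjc : (j : ℂ) = n - d - 1 := by
        have : j = n - d - 1 := by omega
        rw [this]; push_cast; ring
      have hcoef : q ^ (-(m.1 * m.2)) * (((j : ℂ) + 1) * ((d : ℂ) - 2 - j - 2 * e)) =
          q ^ (-(m.1 * m.2)) * (((n : ℂ) - d) * (n + 1)) := by
        rw [hjc, hec]; ring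
      have hne : q ^ (-(m.1 * m.2)) * (((n : ℂ) - d) * (n + 1)) ≠ 0 := by
        refine mul_ne_zero (zpow_ne_zero _ hq) (mul_ne_zero ?_ (Nat.cast_add_one_ne_zero n))
        rw [sub_ne_zero]
        exact_mod_cast (show n ≠ d by omega)
      rw [hcoef, singularCoeff, smul_inv_smul₀ hne]
      abel
    · have h2 : singularVector q m t d (j + 1) = 0 := by
        rw [singularVector_apply, if_neg (by omega)]
      rw [E12N_neg_apply q _ m _ j 0 (by rw [h2]; exact isHomogeneous_zero _ _ _), h0, h1, h2,
        quadMul_eq_zero q _ (singularCoeff_isHomogeneous q m t d _ 0 (by omega)) (by omega),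
        quadContract_eq_zero q _ (singularCoeff_isHomogeneous q m t d _ 1 (by omega)) le_rfl]
      simp

theorem E12N_single_mem_PinN (q : ℂ) (m : ℤ × ℤ) (z : ℤ) :
    E12N q (z : ℂ) m (-m) (Finsupp.single (z + 1) 1) ∈ PinN m := by
  classical
  intro j _
  have hhom : ∀ i, ((Finsupp.single (z + 1) 1 : NN m) i).IsHomogeneous 0 := by
    intro i
    rw [Finsupp.single_apply]
    split_ifs
    · exact isHomogeneous_one _ _
    · exact isHomogeneous_zero _ _ _
  rw [E12N_neg_apply q _ m _ j 0 (hhom _), quadMul_eq_zero q _ (hhom _) zero_le_one,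
    quadContract_eq_zero q _ (hhom _) zero_le_one, Finsupp.single_apply]
  split_ifs with h
  · obtain rfl : z = j := by omega
    simp
  · simp

/-- if `μ ∈ ℤ`, there is a nonzero element `w` of `Q = N/P` with
`E12(−m)·w = 0` in `Q`; i.e. there is `w ∈ N`, `w ∉ P`, with `E12(−m)(w) ∈ P`. -/
theorem stmt14 (q μ : ℂ) (hq : q ≠ 0) (m : ℤ × ℤ) (hμ : ∃ z : ℤ, μ = (z : ℂ)) :
    ∃ w : NN m, w ∉ PinN m ∧ E12N q μ m (-m) w ∈ PinN m := by
  obtain ⟨z, rfl⟩ := hμ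
  rcases le_total z (-2) with hz | hz
  · refine ⟨Finsupp.single (z + 1) 1, fun h => ?_, E12N_single_mem_PinN q m z⟩
    simpa using h (z + 1) (by omega)
  · obtain ⟨d, hd⟩ : ∃ d : ℕ, z = d - 2 := ⟨(z + 2).toNat, by omega⟩
    obtain ⟨t, ht⟩ := exists_ne m
    refine ⟨singularVector q m ⟨t, ht⟩ d, singularVector_notMem_PinN q m _ d, ?_⟩
    have h := E12N_singularVector_mem_PinN q hq m ⟨t, ht⟩ d
    rwa [show ((z : ℤ) : ℂ) = d - 2 by rw [hd]; push_cast; rfl]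
end

section
/- For every b ∈ ℂ and every j ∈ ℤ, in N: Ẽ12(−m)(x_m^{j}) = −(j − b)(j − b − 1 − μ)·q^{−m₁m₂}·x_m^{j−1}. -/
open MvPolynomial Finsupp

/-- The `b`-twisted operator `Ẽ12(n)` on `N`. -/
noncomputable def tE12 (q μ : ℂ) (m : ℤ × ℤ) (b : ℂ) (n : ℤ × ℤ) (g : NN m) : NN m :=
  E12N q μ m n g
    + b • (q ^ (m.2 * n.1) • E22N q m (m + n) (XmZ m (-1) g)
           - q ^ (m.1 * n.2) • E11N q μ m (m + n) (XmZ m (-1) g))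
    - (b * (b - 1) * q ^ (m.2 * n.1 + m.2 * m.1 + m.1 * n.2)) •
        Xop m (m + m + n) (XmZ m (-1) (XmZ m (-1) g))

/-- The `b`-twisted operator `Ẽ11(n)` on `N`. -/
noncomputable def tE11 (q μ : ℂ) (m : ℤ × ℤ) (b : ℂ) (n : ℤ × ℤ) (g : NN m) : NN m :=
  E11N q μ m n g + (b * q ^ (m.2 * n.1)) • Xop m (m + n) (XmZ m (-1) g)

/-- The `b`-twisted operator `Ẽ22(n)` on `N`. -/
noncomputable def tE22 (q : ℂ) (m : ℤ × ℤ) (b : ℂ) (n : ℤ × ℤ) (g : NN m) : NN m :=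
  E22N q m n g - (b * q ^ (m.1 * n.2)) • Xop m (m + n) (XmZ m (-1) g)

/-- The `b`-twisted operator `D̃1 = D1 − b m₁ id` on `N`. -/
noncomputable def tD1 (m : ℤ × ℤ) (b : ℂ) (g : NN m) : NN m := D1N m g - (b * (m.1 : ℂ)) • g

/-- The `b`-twisted operator `D̃2 = D2 − b m₂ id` on `N`. -/
noncomputable def tD2 (m : ℤ × ℤ) (b : ℂ) (g : NN m) : NN m := D2N m g - (b * (m.2 : ℂ)) • g

lemma XmZ_single (m : ℤ × ℤ) (j k : ℤ) (a : MvPolynomial (NVar m) ℂ) :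
    XmZ m j (single k a) = single (k + j) a :=
  mapDomain_single

lemma Xop_self_single (m : ℤ × ℤ) (k : ℤ) (a : MvPolynomial (NVar m) ℂ) :
    Xop m m (single k a) = single (k + 1) a := by
  rw [Xop, dif_pos rfl, XmZ_single]

lemma Dop_self_single_C (m : ℤ × ℤ) (k : ℤ) (c : ℂ) :
    Dop m m (single k (C c)) = single (k - 1) (C (k * c)) := by
  rw [Dop, dif_pos rfl, sum_single_index (by simp)]
  simp

lemma nvars_single_C (m : ℤ × ℤ) (k : ℤ) (c : ℂ) : nvars m (single k (C c)) = {m} := by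
  have h : ∀ l : ℤ, ((single k (C c) : NN m) l).vars = ∅ := by
    intro l
    by_cases hl : k = l
    · subst hl; simp
    · simp [single_eq_of_ne' hl]
  ext p
  simp [nvars, h]

/-- `Ẽ12(−m)(x_m^j) = −(j−b)(j−b−1−μ) q^{−m₁m₂} x_m^{j−1}` for `j ∈ ℤ`. -/
theorem stmt15 (q μ : ℂ) (hq : q ≠ 0) (m : ℤ × ℤ) (b : ℂ) (j : ℤ) :
    tE12 q μ m b (-m) (Finsupp.single j 1) =
      (-((j : ℂ) - b) * ((j : ℂ) - b - 1 - μ) * q ^ (-(m.1 * m.2))) •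
        Finsupp.single (j - 1) (1 : MvPolynomial (NVar m) ℂ) := by
  have hs : ∀ (c d : ℂ) (k : ℤ),
      c • (single k (C d) : NN m) = (c * d) • single k (1 : MvPolynomial (NVar m) ℂ) := by
    intro c d k
    rw [smul_single, smul_single, smul_eq_C_mul, smul_eq_C_mul, ← C_mul, mul_one]
  have hm : m + m + -m = m := by abel
  have hm' : -m + m + m = m := by abel
  have e₁ : -m.2 * m.1 - m.1 * m.2 + m.2 * m.1 = -(m.1 * m.2) := by ring
  have e₂ : -(m.1 * m.2) + m.2 * m.1 - m.1 * m.2 = -(m.1 * m.2) := by ring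
  have e₃ : m.2 * -m.1 = -(m.1 * m.2) := by ring
  have e₄ : m.1 * -m.2 = -(m.1 * m.2) := by ring
  have e₅ : -(-m.1 * -m.2) = -(m.1 * m.2) := by ring
  rw [← C_1 (σ := NVar m) (R := ℂ)]
  simp only [tE12, E12N, E22N, E11N, XmZ_single, nvars_single_C, Finset.sum_singleton,
    Dop_self_single_C, neg_neg, add_neg_cancel, zero_add, hm, hm', Xop_self_single, if_true,
    Prod.fst_neg, Prod.snd_neg, Prod.fst_zero, Prod.snd_zero, mul_zero, zpow_zero,
    e₁, e₂, e₃, e₄, e₅, ← sub_eq_add_neg, sub_add_cancel, hs]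
  module
end
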